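/- Let q be a positive integer, X ≥ 1 a real number, v₀ ∈ ℤⁿ, a ∈ ℤⁿ, and let f* be an absolutely irreducible form of degree D ≥ 2 in n variables with integer (or real) coefficients. Then #{v ∈ ℤⁿ : |v − v₀| ≤ X, f*(v) = 0, v ≡ a (mod q)} ≪_{n,D,ε} 1 + (X/q)^{n−3/2+ε}, uniformly in v₀, a, and the coefficients of f*, where |·| is the sup-norm. -/

import Mathlib

section PlaneCurves

open Polynomial

/-- Newton iteration: a simple root modulo an ideal `I` lifts to a root modulo `I ^ (k + 1)`. -/
theorem exists_approximate_root {R : Type*} [CommRing R] (I : Ideal R) (f : R[X]) (y w : R)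
    (hf : f.eval y ∈ I) (hw : w * f.derivative.eval y - 1 ∈ I) (k : ℕ) :
    ∃ h, h - y ∈ I ∧ f.eval h ∈ I ^ (k + 1) := by
  induction k with
  | zero => exact ⟨y, by simp, by simpa using hf⟩
  | succ k ih =>
    obtain ⟨h, hy, hI⟩ := ih
    have hI1 : f.eval h ∈ I := Ideal.pow_le_self (by omega) hI
    refine ⟨h + -(w * f.eval h), ?_, ?_⟩
    · have : h + -(w * f.eval h) - y = (h - y) - w * f.eval h := by ring
      rw [this]
      exact I.sub_mem hy (I.mul_mem_left _ hI1)
    · obtain ⟨e, he⟩ := f.binomExpansion h (-(w * f.eval h))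
      obtain ⟨d, hd⟩ := f.derivative.evalSubFactor h y
      have h1 : 1 - w * f.derivative.eval h + e * w ^ 2 * f.eval h ∈ I := by
        have : 1 - w * f.derivative.eval h + e * w ^ 2 * f.eval h =
            e * w ^ 2 * f.eval h - (w * f.derivative.eval y - 1) - w * d * (h - y) := by
          linear_combination (-w) * hd
        rw [this]
        exact I.sub_mem (I.sub_mem (I.mul_mem_left _ hI1) hw) (I.mul_mem_left _ hy)
      have h2 : f.eval (h + -(w * f.eval h)) =
          f.eval h * (1 - w * f.derivative.eval h + e * w ^ 2 * f.eval h) := by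
        rw [he]; ring
      rw [h2, pow_succ]
      exact Ideal.mul_mem_mul hI h1

theorem eval_eval_eq_evalEval {R : Type*} [CommRing R] (g : R[X][X]) (r : R[X]) (a : R) :
    (g.eval r).eval a = g.evalEval a (r.eval a) := by
  rw [← map_evalRingHom_eval, eval_map, ← coe_evalRingHom, eval, hom_eval₂]
  simp

theorem evalEval_map_compRingHom {R : Type*} [CommRing R] (g : R[X][X]) (a b c : R) :
    (g.map (compRingHom (X + C c))).evalEval a b = g.evalEval (a + c) b := by
  rw [← map_evalRingHom_eval, ← map_evalRingHom_eval, map_map]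
  congr 2
  ext <;> simp

theorem intCast_evalEval {R : Type*} [CommRing R] (g : ℤ[X][X]) (x y : ℤ) :
    ((g.evalEval x y : ℤ) : R) =
      (g.map (mapRingHom (Int.castRingHom R))).evalEval (x : R) (y : R) := by
  have := map_mapRingHom_evalEval (Int.castRingHom R) x y (p := g)
  simpa using this.symm

theorem dvd_evalEval_sub_evalEval (g : ℤ[X][X]) {p : ℕ} {x y x₀ y₀ : ℤ}
    (hx : (p : ℤ) ∣ x - x₀) (hy : (p : ℤ) ∣ y - y₀) :
    (p : ℤ) ∣ g.evalEval x y - g.evalEval x₀ y₀ := by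
  rw [← ZMod.intCast_zmod_eq_zero_iff_dvd] at *
  push_cast [sub_eq_zero] at *
  rw [intCast_evalEval, intCast_evalEval, hx, hy]

/-- Integer points of a plane curve that are congruent modulo `p` to a point where the
`Y`-derivative is a unit lie `p`-adically on the graph of a polynomial. -/
theorem exists_padic_parametrization (g : ℤ[X][X]) (p : ℕ) [hp : Fact p.Prime] (x₀ y₀ : ℤ) (s : ℕ)
    (h₀ : g.evalEval x₀ y₀ = 0) (hd : ¬ (p : ℤ) ∣ g.derivative.evalEval x₀ y₀) :
    ∃ h : ℤ[X], ∀ x y : ℤ, g.evalEval x y = 0 → (p : ℤ) ∣ x - x₀ → (p : ℤ) ∣ y - y₀ →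
      (p : ℤ) ^ s ∣ y - h.eval (x - x₀) := by
  have hpZ : Prime (p : ℤ) := Nat.prime_iff_prime_int.mp hp.out
  let I : Ideal ℤ[X] := Ideal.span {C (p : ℤ), X}
  let f : ℤ[X][X] := g.map (compRingHom (X + C x₀))
  have memI (b : ℤ[X]) : b ∈ I ↔ (p : ℤ) ∣ b.eval 0 := by
    rw [Ideal.mem_span_pair]
    constructor
    · rintro ⟨u, v, rfl⟩
      simp
    · rintro ⟨u, hu⟩
      have := b.divX_mul_X_add
      rw [coeff_zero_eq_eval_zero, hu] at this
      exact ⟨C u, b.divX, by rw [← C_mul, mul_comm u, add_comm]; exact this⟩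
  have evI (a : ℤ) (ha : (p : ℤ) ∣ a) (k : ℕ) (b : ℤ[X]) (hb : b ∈ I ^ k) :
      (p : ℤ) ^ k ∣ b.eval a := by
    have h1 : I ≤ Ideal.comap (evalRingHom a) (Ideal.span {(p : ℤ)}) := by
      rw [Ideal.span_le]
      rintro _ (rfl | rfl) <;> simp [Ideal.mem_span_singleton, ha]
    have h2 := Ideal.le_comap_pow (evalRingHom a) (K := Ideal.span {(p : ℤ)}) k
      (Ideal.pow_right_mono h1 k hb)
    simpa [Ideal.span_singleton_pow, Ideal.mem_span_singleton] using h2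
  have hcop : IsCoprime (p : ℤ) (g.derivative.evalEval x₀ y₀) :=
    (Prime.coprime_iff_not_dvd hpZ).mpr hd
  obtain ⟨u, w, huw⟩ := hcop
  obtain ⟨h, hhy, hhs⟩ := exists_approximate_root I f (C y₀) (C w)
    (by rw [memI, eval_eval_eq_evalEval]
        simp only [eval_C, f, evalEval_map_compRingHom, zero_add, h₀, dvd_zero])
    (by rw [memI, eval_sub, eval_mul, eval_eval_eq_evalEval]
        simp only [eval_C, f, derivative_map, evalEval_map_compRingHom, zero_add, eval_one]
        exact ⟨-u, by linear_combination huw⟩) s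
  refine ⟨h, fun x y hxy hx hy => ?_⟩
  have h1 := evI _ hx _ _ hhs
  rw [eval_eval_eq_evalEval] at h1
  simp only [f, evalEval_map_compRingHom, sub_add_cancel] at h1
  have h2 := evI _ hx 1 _ ((pow_one I).symm ▸ hhy)
  rw [pow_one, eval_sub, eval_C] at h2
  set t := h.eval (x - x₀)
  have hty : (p : ℤ) ∣ t - y := by
    have := dvd_sub h2 hy
    rwa [sub_sub_sub_cancel_right] at this
  obtain ⟨k, hk⟩ := (g.map (evalRingHom x)).binomExpansion y (t - y)
  rw [add_sub_cancel, derivative_map, map_evalRingHom_eval, map_evalRingHom_eval,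
    map_evalRingHom_eval, hxy, zero_add] at hk
  rw [hk, show g.derivative.evalEval x y * (t - y) + k * (t - y) ^ 2 =
    (t - y) * (g.derivative.evalEval x y + k * (t - y)) by ring] at h1
  have hnd : ¬ (p : ℤ) ∣ g.derivative.evalEval x y + k * (t - y) := by
    intro hdvd
    apply hd
    have h3 := (dvd_add_left (hty.mul_left k)).mp hdvd
    exact (dvd_sub_right h3).mp (dvd_evalEval_sub_evalEval g.derivative hx hy)
  have h4 := hpZ.pow_dvd_of_dvd_mul_right (s + 1) hnd h1
  rw [← neg_sub, dvd_neg]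
  exact (pow_dvd_pow _ (Nat.le_succ s)).trans h4
theorem card_box_gt {p M B : ℕ} (hM : 1 ≤ M) (hB : 1 ≤ B) (hp : 1 ≤ p)
    (hlt : (2 * M) ^ (2 * M) * B ^ (M ^ 2) < p ^ (M * (2 * M - 1))) :
    p ^ (M * (2 * M + 1)) <
      ∏ a : Fin M × Fin 2, ((p ^ (2 * M) - 1) / (2 * M) / B ^ (a.1.1 + a.2.1) + 1) := by
  set U := (p ^ (2 * M) - 1) / (2 * M) with hU
  by_contra! hcon
  have hw : ∏ a : Fin M × Fin 2, B ^ (a.1.1 + a.2.1) = B ^ (M ^ 2) := by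
    rw [Finset.prod_pow_eq_pow_sum, Fintype.sum_prod_type]
    congr 1
    simp only [Fin.sum_univ_two, Fin.val_zero, Fin.val_one]
    rw [Fin.sum_univ_eq_sum_range (fun i => i + 0 + (i + 1)) M]
    clear * -
    induction M with
    | zero => simp
    | succ n ih => rw [Finset.sum_range_succ, ih]; ring
  have h1 : (U + 1) ^ (2 * M) ≤
      (∏ a : Fin M × Fin 2, (U / B ^ (a.1.1 + a.2.1) + 1)) * B ^ (M ^ 2) := by
    rw [← hw, ← Finset.prod_mul_distrib]
    have : (U + 1) ^ (2 * M) = ∏ _a : Fin M × Fin 2, (U + 1) := by simp [mul_comm]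
    rw [this]
    refine Finset.prod_le_prod' fun a _ => ?_
    exact Nat.lt_mul_of_div_lt (Nat.lt_succ_self _) (by positivity)
  have h2 : p ^ (2 * M) ≤ 2 * M * (U + 1) := by
    have := Nat.lt_mul_of_div_lt (Nat.lt_succ_self U) (show 0 < 2 * M by omega)
    rw [Nat.succ_eq_add_one, mul_comm (U + 1)] at this
    omega
  have h3 : p ^ (M * (2 * M - 1)) * p ^ (M * (2 * M + 1)) = (p ^ (2 * M)) ^ (2 * M) := by
    rw [← pow_add, ← pow_mul]
    congr 1
    obtain ⟨m, rfl⟩ := Nat.exists_eq_add_of_le hM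
    rw [show 2 * (1 + m) - 1 = 2 * m + 1 by omega]
    ring
  have h4 : (p ^ (2 * M)) ^ (2 * M) ≤
      (2 * M) ^ (2 * M) * (p ^ (M * (2 * M + 1)) * B ^ (M ^ 2)) := by
    calc _ ≤ (2 * M * (U + 1)) ^ (2 * M) := Nat.pow_le_pow_left h2 _
      _ = (2 * M) ^ (2 * M) * (U + 1) ^ (2 * M) := mul_pow ..
      _ ≤ _ := Nat.mul_le_mul_left _ (h1.trans (Nat.mul_le_mul_right _ hcon))
  rw [← h3] at h4
  have : 0 < p ^ (M * (2 * M + 1)) := by positivity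
  nlinarith

/-- A small auxiliary polynomial `u + v Y`, obtained from the pigeonhole principle, vanishing at all
integer points of a box lying in a residue class on which `Y` is `p`-adically a function of `X`. -/
theorem exists_auxiliary_polynomial {p M B : ℕ} [NeZero p] (hM : 1 ≤ M) (hB : 1 ≤ B)
    (hlt : (2 * M) ^ (2 * M) * B ^ (M ^ 2) < p ^ (M * (2 * M - 1))) (h : ℤ[X]) (x₀ : ℤ) :
    ∃ u v : ℤ[X], (u ≠ 0 ∨ v ≠ 0) ∧ u.natDegree ≤ M ∧ v.natDegree ≤ M ∧
      ∀ x y : ℤ, 0 ≤ x → x ≤ B → 0 ≤ y → y ≤ B → (p : ℤ) ∣ x - x₀ →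
        (p : ℤ) ^ (2 * M) ∣ y - h.eval (x - x₀) → u.eval x + v.eval x * y = 0 := by
  have hp : 1 ≤ p := Nat.one_le_iff_ne_zero.mpr (NeZero.ne p)
  set U := (p ^ (2 * M) - 1) / (2 * M) with hU
  let q (b : Fin M × Fin 2 → ℤ) : ℤ[X] := ∑ a, C (b a) * ((X + C x₀) ^ a.1.1 * h ^ a.2.1)
  let Ψ (b : Fin M × Fin 2 → ℕ) (k : Fin (2 * M)) : ZMod (p ^ (2 * M - k.1)) :=
    ((q (fun a => b a)).coeff k : ℤ)
  have hcard : Fintype.card ((k : Fin (2 * M)) → ZMod (p ^ (2 * M - k.1))) =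
      p ^ (M * (2 * M + 1)) := by
    rw [Fintype.card_pi]
    simp only [ZMod.card]
    rw [Fin.prod_univ_eq_prod_range (fun k => p ^ (2 * M - k)) (2 * M),
      Finset.prod_pow_eq_pow_sum]
    congr 1
    have h1 : ∑ k ∈ Finset.range (2 * M), (2 * M - k) = ∑ k ∈ Finset.range (2 * M), (k + 1) := by
      rw [← Finset.sum_range_reflect]
      refine Finset.sum_congr rfl fun k hk => ?_
      have := Finset.mem_range.mp hk
      omega
    have h2 := Finset.sum_range_id_mul_two (2 * M + 1)
    rw [Finset.sum_range_succ'] at h2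
    rw [h1]
    simp only [add_zero, Nat.add_sub_cancel] at h2
    linarith
  obtain ⟨b, hb, b', hb', hne, heq⟩ := Finset.exists_ne_map_eq_of_card_lt_of_maps_to
    (s := Fintype.piFinset fun a : Fin M × Fin 2 => Finset.range (U / B ^ (a.1.1 + a.2.1) + 1))
    (t := Finset.univ) (f := Ψ)
    (by rw [Finset.card_univ, hcard, Fintype.card_piFinset]
        simpa using card_box_gt hM hB hp hlt) (fun _ _ => by simp)
  simp only [Fintype.mem_piFinset, Finset.mem_range, Nat.lt_succ_iff] at hb hb'
  let c (a : Fin M × Fin 2) : ℤ := b a - b' a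
  have hc (a : Fin M × Fin 2) : |c a| * B ^ (a.1.1 + a.2.1) ≤ U := by
    have h1 : |c a| ≤ ((U / B ^ (a.1.1 + a.2.1) : ℕ) : ℤ) := by
      have := hb a
      have := hb' a
      rw [abs_le]
      constructor <;> simp only [c] <;> omega
    calc _ ≤ ((U / B ^ (a.1.1 + a.2.1) : ℕ) : ℤ) * B ^ (a.1.1 + a.2.1) := by gcongr
      _ ≤ U := by exact_mod_cast Nat.div_mul_le_self _ _
  have hq (k : ℕ) (hk : k < 2 * M) : (p : ℤ) ^ (2 * M - k) ∣ (q c).coeff k := by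
    have h1 := congrFun heq ⟨k, hk⟩
    have h2 : q c = q (fun a => b a) - q (fun a => b' a) := by
      simp only [q, c, C_sub, sub_mul, Finset.sum_sub_distrib]
    rw [h2, coeff_sub]
    simp only [Ψ] at h1
    rw [eq_comm, ZMod.intCast_eq_intCast_iff_dvd_sub] at h1
    exact_mod_cast h1
  have hdeg (j : Fin 2) : (∑ i : Fin M, C (c (i, j)) * X ^ i.1).natDegree ≤ M :=
    natDegree_sum_le_of_forall_le _ _ fun i _ =>
      (natDegree_C_mul_X_pow_le _ _).trans i.2.le
  have hcoef (j : Fin 2) (i : Fin M) :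
      (∑ i : Fin M, C (c (i, j)) * X ^ i.1).coeff i = c (i, j) := by
    simp [coeff_X_pow, Fin.val_inj]
  refine ⟨∑ i : Fin M, C (c (i, 0)) * X ^ i.1, ∑ i : Fin M, C (c (i, 1)) * X ^ i.1, ?_,
    hdeg 0, hdeg 1, fun x y hx0 hxB hy0 hyB hx hy => ?_⟩
  · by_contra! hcon
    apply hne
    funext ⟨i, j⟩
    have : c (i, j) = 0 := by
      rw [← hcoef]
      fin_cases j
      · exact (congrArg (coeff · i.1) hcon.1).trans (coeff_zero _)
      · exact (congrArg (coeff · i.1) hcon.2).trans (coeff_zero _)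
    simp only [c] at this
    omega
  · have hval : (∑ i : Fin M, C (c (i, 0)) * X ^ i.1).eval x +
        (∑ i : Fin M, C (c (i, 1)) * X ^ i.1).eval x * y = ∑ a, c a * (x ^ a.1.1 * y ^ a.2.1) := by
      rw [Fintype.sum_prod_type]
      simp only [eval_finsetSum, eval_mul, eval_C, eval_pow, eval_X, Fin.sum_univ_two,
        Finset.sum_add_distrib, Finset.sum_mul, Fin.val_zero, Fin.val_one, pow_zero, pow_one,
        mul_one, mul_assoc]
    rw [hval]
    apply Int.eq_zero_of_abs_lt_dvd (m := (p : ℤ) ^ (2 * M))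
    · have h1 : (p : ℤ) ^ (2 * M) ∣ (q c).eval (x - x₀) := by
        rw [eval_eq_sum_range]
        refine Finset.dvd_sum fun k _ => ?_
        rcases lt_or_ge k (2 * M) with hk | hk
        · have := mul_dvd_mul (hq k hk) (pow_dvd_pow_of_dvd hx k)
          rwa [← pow_add, Nat.sub_add_cancel hk.le] at this
        · exact ((pow_dvd_pow _ hk).trans (pow_dvd_pow_of_dvd hx k)).mul_left _
      have h2 : (p : ℤ) ^ (2 * M) ∣ ∑ a, c a * (x ^ a.1.1 * y ^ a.2.1) - (q c).eval (x - x₀) := by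
        simp only [q, eval_finsetSum, eval_mul, eval_C, eval_pow, eval_add, eval_X, sub_add_cancel]
        rw [← Finset.sum_sub_distrib]
        refine Finset.dvd_sum fun a _ => ?_
        rw [← mul_sub, ← mul_sub]
        exact ((hy.trans (sub_dvd_pow_sub_pow _ _ _)).mul_left _).mul_left _
      have := dvd_add h2 h1
      rwa [sub_add_cancel] at this
    · have h1 : |∑ a, c a * (x ^ a.1.1 * y ^ a.2.1)| ≤ ∑ _a : Fin M × Fin 2, (U : ℤ) := by
        refine (Finset.abs_sum_le_sum_abs _ _).trans (Finset.sum_le_sum fun a _ => ?_)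
        rw [abs_mul, abs_of_nonneg (a := x ^ a.1.1 * y ^ a.2.1) (by positivity)]
        refine le_trans ?_ (hc a)
        rw [pow_add]
        gcongr
      have h2 : 2 * M * U < p ^ (2 * M) := by
        have := Nat.mul_div_le (p ^ (2 * M) - 1) (2 * M)
        rw [← hU] at this
        have h3 : 1 ≤ p ^ (2 * M) := Nat.one_le_pow _ _ hp
        omega
      simp only [Finset.sum_const, Finset.card_univ, Fintype.card_prod, Fintype.card_fin,
        nsmul_eq_mul] at h1
      calc _ ≤ _ := h1
        _ = ((2 * M * U : ℕ) : ℤ) := by push_cast; ring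
        _ < _ := by exact_mod_cast h2
/-- `g` has total degree at most `D`, and the coefficient of `Y ^ D` in `g` is a nonzero
constant. -/
structure IsPlaneCurve {R : Type*} [CommRing R] (D : ℕ) (g : R[X][X]) : Prop where
  natDegree_coeff_le : ∀ j, (g.coeff j).natDegree ≤ D - j
  natDegree_le : g.natDegree ≤ D
  coeff_ne_zero : g.coeff D ≠ 0

namespace IsPlaneCurve

variable {R : Type*} [CommRing R] {D : ℕ} {g : R[X][X]}

theorem natDegree_eq (hg : IsPlaneCurve D g) : g.natDegree = D :=
  le_antisymm hg.natDegree_le (le_natDegree_of_ne_zero hg.coeff_ne_zero)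

theorem exists_coeff_eq_C (hg : IsPlaneCurve D g) : ∃ c : R, c ≠ 0 ∧ g.coeff D = C c := by
  have h := hg.natDegree_coeff_le D
  rw [Nat.sub_self] at h
  have h1 := eq_C_of_natDegree_le_zero h
  refine ⟨_, fun h0 => hg.coeff_ne_zero ?_, h1⟩
  rw [h1, h0, C_0]

theorem map {S : Type*} [CommRing S] (hg : IsPlaneCurve D g) {f : R →+* S}
    (hf : Function.Injective f) : IsPlaneCurve D (g.map (mapRingHom f)) where
  natDegree_coeff_le j := by
    rw [coeff_map]
    exact natDegree_map_le.trans (hg.natDegree_coeff_le j)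
  natDegree_le := natDegree_map_le.trans hg.natDegree_le
  coeff_ne_zero := by
    rw [coeff_map, coe_mapRingHom]
    exact (Polynomial.map_ne_zero_iff hf).mpr hg.coeff_ne_zero

theorem derivative [CharZero R] [IsDomain R] (hg : IsPlaneCurve (D + 1) g) :
    IsPlaneCurve D g.derivative where
  natDegree_coeff_le j := by
    rw [coeff_derivative, ← Nat.cast_succ, ← C_eq_natCast]
    refine (natDegree_mul_C_le _ _).trans ((hg.natDegree_coeff_le _).trans ?_)
    omega
  natDegree_le := (natDegree_derivative_le g).trans (by have := hg.natDegree_le; omega)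
  coeff_ne_zero := by
    rw [coeff_derivative]
    exact mul_ne_zero hg.coeff_ne_zero (by exact_mod_cast D.succ_ne_zero)

theorem natDegree_eval_le (hg : IsPlaneCurve D g) {r : R[X]} (hr : r.natDegree ≤ 1) :
    (g.eval r).natDegree ≤ D := by
  rw [eval_eq_sum_range]
  refine natDegree_sum_le_of_forall_le _ _ fun j hj => ?_
  have hj' : j ≤ D := (Nat.lt_succ_iff.mp (Finset.mem_range.mp hj)).trans hg.natDegree_le
  have h1 := hg.natDegree_coeff_le j
  have h2 : (r ^ j).natDegree ≤ j := natDegree_pow_le.trans (by nlinarith)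
  exact natDegree_mul_le.trans (by omega)

theorem map_evalRingHom_ne_zero (hg : IsPlaneCurve D g) (x : R) : g.map (evalRingHom x) ≠ 0 := by
  obtain ⟨c, hc, h⟩ := hg.exists_coeff_eq_C
  intro h0
  have := congrArg (coeff · D) h0
  simp [coeff_map, h, hc] at this

theorem natDegree_root_le_one [IsDomain R] (hg : IsPlaneCurve D g) {r : R[X]}
    (hr : g.eval r = 0) : r.natDegree ≤ 1 := by
  by_contra! hlt
  obtain ⟨c, hc, h⟩ := hg.exists_coeff_eq_C
  have h0 : (g.eval r).coeff (D * r.natDegree) = 0 := by rw [hr, coeff_zero]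
  rw [eval_eq_sum_range, hg.natDegree_eq, finsetSum_coeff, Finset.sum_range_succ,
    Finset.sum_eq_zero, zero_add, h, coeff_C_mul, coeff_pow_mul_natDegree] at h0
  · have hr0 : r ≠ 0 := by rintro rfl; simp at hlt
    exact mul_ne_zero hc (pow_ne_zero _ (leadingCoeff_ne_zero.mpr hr0)) h0
  · intro j hj
    have hj' := Finset.mem_range.mp hj
    apply coeff_eq_zero_of_natDegree_lt
    refine natDegree_mul_le.trans_lt ?_
    have h1 := hg.natDegree_coeff_le j
    have h2 : (r ^ j).natDegree ≤ j * r.natDegree := natDegree_pow_le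
    obtain ⟨k, rfl⟩ := Nat.exists_eq_add_of_lt hj'
    have h3 : j + k + 1 - j = k + 1 := by omega
    rw [h3] at h1
    nlinarith

/-- A rational function that is a root of a plane curve is a polynomial. -/
theorem exists_root_of_scaleRoots {K : Type*} [Field K] {g : K[X][X]} (hg : IsPlaneCurve D g)
    {u v : K[X]} (hv : v ≠ 0) (h : (g.scaleRoots v).eval (-u) = 0) :
    ∃ r : K[X], g.eval r = 0 ∧ v * r = -u := by
  obtain ⟨c, hc, hcD⟩ := hg.exists_coeff_eq_C
  let φ := algebraMap K[X] (FractionRing K[X])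
  have hinj : Function.Injective φ := IsFractionRing.injective _ _
  have hφv : φ v ≠ 0 := (map_ne_zero_iff φ hinj).mpr hv
  set z := φ (-u) / φ v with hz
  have hgz : g.eval₂ φ z = 0 := by
    have h1 := scaleRoots_eval₂_mul (p := g) φ z v
    rw [hz, mul_div_cancel₀ _ hφv, eval₂_at_apply, h, map_zero] at h1
    exact (mul_eq_zero.mp h1.symm).resolve_left (pow_ne_zero _ hφv)
  have hint : IsIntegral K[X] z := by
    refine ⟨C (C c⁻¹) * g, ?_, ?_⟩
    · rw [Monic, leadingCoeff, natDegree_C_mul (by simpa using hc), hg.natDegree_eq, coeff_C_mul,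
        hcD, ← C_mul, inv_mul_cancel₀ hc, C_1]
    · rw [eval₂_mul, hgz, mul_zero]
  obtain ⟨r, hr⟩ := IsIntegrallyClosed.isIntegral_iff.mp hint
  refine ⟨r, hinj ?_, hinj ?_⟩
  · rw [← eval₂_at_apply, map_zero]
    exact hr ▸ hgz
  · rw [map_mul]
    rw [show φ r = z from hr, hz, mul_div_cancel₀ _ hφv]

end IsPlaneCurve

theorem Polynomial.card_le_of_eval_eq_zero {R : Type*} [CommRing R] [IsDomain R] {p : R[X]}
    (hp : p ≠ 0) {d : ℕ} (hd : p.natDegree ≤ d) (S : Finset R) (hS : ∀ x ∈ S, p.eval x = 0) :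
    S.card ≤ d :=
  (card_le_degree_of_subset_roots fun x hx => (mem_roots hp).mpr (hS x hx)).trans hd

theorem IsPlaneCurve.card_le_mul_card_image {D : ℕ} {g : ℤ[X][X]} (hg : IsPlaneCurve D g)
    (S : Finset (ℤ × ℤ)) (hS : ∀ P ∈ S, g.evalEval P.1 P.2 = 0) :
    S.card ≤ D * (S.image Prod.fst).card := by
  refine Finset.card_le_mul_card_image S D fun x _ => ?_
  rw [← Finset.card_image_of_injOn (f := Prod.snd)]
  · refine card_le_of_eval_eq_zero (hg.map_evalRingHom_ne_zero x)
      (natDegree_map_le.trans hg.natDegree_le) _ fun y hy => ?_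
    obtain ⟨P, hP, rfl⟩ := Finset.mem_image.mp hy
    obtain ⟨hPS, rfl⟩ := Finset.mem_filter.mp hP
    rw [map_evalRingHom_eval, hS P hPS]
  · intro P hP Q hQ h
    have hP := (Finset.mem_filter.mp hP).2
    have hQ := (Finset.mem_filter.mp hQ).2
    exact Prod.ext (hP.trans hQ.symm) h

/-- The lines contained in a plane curve over `ℤ`, as polynomials over `ℚ`. -/
noncomputable def rationalRoots (g : ℤ[X][X]) : Finset ℚ[X] :=
  (g.map (mapRingHom (Int.castRingHom ℚ))).roots.toFinset

theorem IsPlaneCurve.mem_rationalRoots {D : ℕ} {g : ℤ[X][X]} (hg : IsPlaneCurve D g) {r : ℚ[X]} :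
    r ∈ rationalRoots g ↔ (g.map (mapRingHom (Int.castRingHom ℚ))).eval r = 0 := by
  have hg' := hg.map (f := Int.castRingHom ℚ) Int.cast_injective
  have : g.map (mapRingHom (Int.castRingHom ℚ)) ≠ 0 := fun h => hg'.coeff_ne_zero (by rw [h]; simp)
  rw [rationalRoots, Multiset.mem_toFinset, mem_roots this, IsRoot]

theorem IsPlaneCurve.card_rationalRoots_le {D : ℕ} {g : ℤ[X][X]} (hg : IsPlaneCurve D g) :
    (rationalRoots g).card ≤ D :=
  (Multiset.toFinset_card_le _).trans <| (card_roots' _).trans <|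
    natDegree_map_le.trans hg.natDegree_le

/-- A curve meets the graph of a rational function in few integer points outside its lines. -/
theorem IsPlaneCurve.card_le_of_auxiliary {D M : ℕ} {g : ℤ[X][X]} (hg : IsPlaneCurve D g)
    {u v : ℤ[X]} (huv : u ≠ 0 ∨ v ≠ 0) (hu : u.natDegree ≤ M) (hv : v.natDegree ≤ M)
    (S : Finset (ℤ × ℤ)) (hS : ∀ P ∈ S, g.evalEval P.1 P.2 = 0)
    (hS' : ∀ P ∈ S, u.eval P.1 + v.eval P.1 * P.2 = 0)
    (hSr : ∀ P ∈ S, ∀ r ∈ rationalRoots g, r.eval (P.1 : ℚ) ≠ P.2) :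
    S.card ≤ D * (D + D * M + M) := by
  refine (hg.card_le_mul_card_image S hS).trans (Nat.mul_le_mul_left _ ?_)
  rcases eq_or_ne v 0 with rfl | hv0
  · have hu0 : u ≠ 0 := by simpa using huv
    refine (card_le_of_eval_eq_zero hu0 hu _ fun x hx => ?_).trans (by omega)
    obtain ⟨P, hP, rfl⟩ := Finset.mem_image.mp hx
    simpa using hS' P hP
  rcases eq_or_ne ((g.scaleRoots v).eval (-u)) 0 with h0 | h0
  · let ι := Int.castRingHom ℚ
    have hι : Function.Injective ι := Int.cast_injective
    have hι' : Function.Injective (mapRingHom ι) := Polynomial.map_injective ι hι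
    have hg' := hg.map (f := ι) hι
    obtain ⟨r, hr, hvr⟩ := hg'.exists_root_of_scaleRoots (u := u.map ι) (v := v.map ι)
      ((Polynomial.map_ne_zero_iff hι).mpr hv0) (by
        have h1 := congrArg (Polynomial.map ι) h0
        rw [← map_mapRingHom_eval_map, map_scaleRoots _ _ _ (by
          rw [map_ne_zero_iff _ hι', leadingCoeff, hg.natDegree_eq]
          exact hg.coeff_ne_zero)] at h1
        simpa using h1)
    refine (card_le_of_eval_eq_zero hv0 hv _ fun x hx => ?_).trans (by omega)
    obtain ⟨P, hP, rfl⟩ := Finset.mem_image.mp hx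
    by_contra hne
    refine hSr P hP r (hg.mem_rationalRoots.mpr hr) ?_
    have h1 := congrArg (eval (P.1 : ℚ)) hvr
    have h2 : ((u.eval P.1 + v.eval P.1 * P.2 : ℤ) : ℚ) = 0 := by rw [hS' P hP, Int.cast_zero]
    have e (w : ℤ[X]) : (w.map ι).eval (P.1 : ℚ) = ((w.eval P.1 : ℤ) : ℚ) := by
      simp [ι, eval_intCast_map]
    rw [eval_mul, eval_neg, e, e] at h1
    push_cast at h2
    have h3 : ((v.eval P.1 : ℤ) : ℚ) ≠ 0 := by exact_mod_cast hne
    apply mul_left_cancel₀ h3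
    linarith
  · have hdeg : ((g.scaleRoots v).eval (-u)).natDegree ≤ D + D * M := by
      rw [eval_eq_sum_range]
      refine natDegree_sum_le_of_forall_le _ _ fun j hj => ?_
      rw [natDegree_scaleRoots, hg.natDegree_eq] at hj
      have hj' : j ≤ D := Nat.lt_succ_iff.mp (Finset.mem_range.mp hj)
      rw [coeff_scaleRoots, hg.natDegree_eq]
      have h1 := hg.natDegree_coeff_le j
      have h2 : (v ^ (D - j)).natDegree ≤ (D - j) * M :=
        natDegree_pow_le.trans (Nat.mul_le_mul_left _ hv)
      have h3 : ((-u) ^ j).natDegree ≤ j * M :=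
        natDegree_pow_le.trans (Nat.mul_le_mul_left _ (by rwa [natDegree_neg]))
      have h4 : (D - j) * M + j * M = D * M := by rw [← add_mul, Nat.sub_add_cancel hj']
      refine natDegree_mul_le.trans ?_
      have := natDegree_mul_le (p := g.coeff j) (q := v ^ (D - j))
      omega
    refine (card_le_of_eval_eq_zero h0 hdeg _ fun x hx => ?_).trans (by omega)
    obtain ⟨P, hP, rfl⟩ := Finset.mem_image.mp hx
    have h1 : (-u).eval P.1 = (evalRingHom P.1) v * P.2 := by
      have := hS' P hP
      rw [eval_neg, coe_evalRingHom]
      linarith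
    rw [eval_eval_eq_evalEval, h1, ← eval₂_evalRingHom, scaleRoots_eval₂_mul, eval₂_evalRingHom,
      hS P hP, mul_zero]
/-- A plane curve has at most `D * p` points over `𝔽_p` at which the `Y`-derivative is nonzero. -/
theorem card_smooth_points_mod_le {D : ℕ} {g : ℤ[X][X]} (hg : IsPlaneCurve D g)
    (p : ℕ) [hp : Fact p.Prime] (S : Finset (ℤ × ℤ)) (hS : ∀ P ∈ S, g.evalEval P.1 P.2 = 0)
    (hd : ∀ P ∈ S, ¬ (p : ℤ) ∣ g.derivative.evalEval P.1 P.2) :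
    (S.image fun P => ((P.1 : ZMod p), (P.2 : ZMod p))).card ≤ D * p := by
  let ι := Int.castRingHom (ZMod p)
  let G := g.map (mapRingHom ι)
  set I := S.image fun P => ((P.1 : ZMod p), (P.2 : ZMod p)) with hI
  have hG : ∀ Q ∈ I, G.evalEval Q.1 Q.2 = 0 ∧ G.derivative.evalEval Q.1 Q.2 ≠ 0 := by
    intro Q hQ
    obtain ⟨P, hP, rfl⟩ := Finset.mem_image.mp hQ
    have h1 := hd P hP
    rw [← ZMod.intCast_zmod_eq_zero_iff_dvd, intCast_evalEval, ← derivative_map] at h1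
    exact ⟨by rw [← intCast_evalEval, hS P hP, Int.cast_zero], h1⟩
  have h1 : I.card ≤ D * (I.image Prod.fst).card := by
    refine Finset.card_le_mul_card_image I D fun x hx => ?_
    rw [← Finset.card_image_of_injOn (f := Prod.snd)]
    · refine card_le_of_eval_eq_zero (p := G.map (evalRingHom x)) ?_
        (natDegree_map_le.trans (natDegree_map_le.trans hg.natDegree_le)) _ fun y hy => ?_
      · obtain ⟨Q, hQ, rfl⟩ := Finset.mem_image.mp hx
        intro h0
        apply (hG Q hQ).2
        rw [← map_evalRingHom_eval, ← derivative_map, h0, derivative_zero, eval_zero]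
      · obtain ⟨Q, hQ, rfl⟩ := Finset.mem_image.mp hy
        obtain ⟨hQI, rfl⟩ := Finset.mem_filter.mp hQ
        rw [map_evalRingHom_eval, (hG Q hQI).1]
    · intro P hP Q hQ h
      have hP := (Finset.mem_filter.mp hP).2
      have hQ := (Finset.mem_filter.mp hQ).2
      exact Prod.ext (hP.trans hQ.symm) h
  refine h1.trans (Nat.mul_le_mul_left _ ?_)
  refine (Finset.card_le_univ _).trans ?_
  rw [ZMod.card]

/-- The determinant-method bound for the points of a curve that are smooth modulo one prime. -/
theorem card_smooth_points_le {D M B : ℕ} {g : ℤ[X][X]} (hg : IsPlaneCurve D g)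
    {p : ℕ} (hp : p.Prime) (hM : 1 ≤ M) (hB : 1 ≤ B)
    (hlt : (2 * M) ^ (2 * M) * B ^ (M ^ 2) < p ^ (M * (2 * M - 1)))
    (S : Finset (ℤ × ℤ)) (hS : ∀ P ∈ S, g.evalEval P.1 P.2 = 0)
    (hbox : ∀ P ∈ S, (0 ≤ P.1 ∧ P.1 ≤ B) ∧ (0 ≤ P.2 ∧ P.2 ≤ B))
    (hd : ∀ P ∈ S, ¬ (p : ℤ) ∣ g.derivative.evalEval P.1 P.2)
    (hSr : ∀ P ∈ S, ∀ r ∈ rationalRoots g, r.eval (P.1 : ℚ) ≠ P.2) :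
    S.card ≤ D * (D + D * M + M) * (D * p) := by
  have : Fact p.Prime := ⟨hp⟩
  have : NeZero p := ⟨hp.ne_zero⟩
  refine (Finset.card_le_mul_card_image (f := fun P => ((P.1 : ZMod p), (P.2 : ZMod p)))
    S (D * (D + D * M + M)) fun Q hQ => ?_).trans
    (Nat.mul_le_mul_left _ (card_smooth_points_mod_le hg p S hS hd))
  obtain ⟨P₀, hP₀, rfl⟩ := Finset.mem_image.mp hQ
  obtain ⟨h, hh⟩ := exists_padic_parametrization g p P₀.1 P₀.2 (2 * M) (hS P₀ hP₀) (hd P₀ hP₀)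
  obtain ⟨u, v, huv, hu, hv, haux⟩ := exists_auxiliary_polynomial hM hB hlt h P₀.1
  refine hg.card_le_of_auxiliary huv hu hv _ (fun P hP => ?_) (fun P hP => ?_) (fun P hP => ?_)
  all_goals obtain ⟨hPS, hPQ⟩ := Finset.mem_filter.mp hP
  · exact hS P hPS
  · obtain ⟨⟨h1, h2⟩, h3, h4⟩ := hbox P hPS
    rw [Prod.mk.injEq, eq_comm, ZMod.intCast_eq_intCast_iff_dvd_sub, eq_comm,
      ZMod.intCast_eq_intCast_iff_dvd_sub] at hPQ
    exact haux _ _ h1 h2 h3 h4 hPQ.1 (hh _ _ (hS P hPS) hPQ.1 hPQ.2)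
  · exact hSr P hPS

/-- An integral linear system with bounded entries that has a rational solution with nonzero `e`-th
coordinate has a bounded integral one. -/
theorem exists_bounded_int_solution {κ ι : Type*} [Fintype ι] [DecidableEq ι] (e : ι)
    (v : κ → ι → ℤ) {A : ℤ} (hA : 1 ≤ A) (hv : ∀ k i, |v k i| ≤ A)
    (a : ι → ℚ) (ha : ∀ k, ∑ i, (v k i : ℚ) * a i = 0) (hae : a e ≠ 0) :
    ∃ b : ι → ℤ, (∀ k, ∑ i, v k i * b i = 0) ∧ b e ≠ 0 ∧
      ∀ i, |b i| ≤ (Fintype.card ι).factorial * A ^ Fintype.card ι := by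
  classical
  let wZ : κ ⊕ ι → ι → ℤ := Sum.elim v (fun j => Pi.single j 1)
  let w (x : κ ⊕ ι) (i : ι) : ℚ := wZ x i
  have hwl (k : κ) : w (Sum.inl k) = fun i => (v k i : ℚ) := rfl
  have hwr (j : ι) : w (Sum.inr j) = Pi.single j 1 := by
    funext i
    simp [w, wZ, Pi.single_apply]
  have hwA (x : κ ⊕ ι) (i : ι) : |wZ x i| ≤ A := by
    rcases x with k | j
    · exact hv k i
    · simp only [wZ, Sum.elim_inr, Pi.single_apply]
      split_ifs <;> simp <;> omega
  have h0 : LinearIndepOn ℚ w ∅ := linearIndepOn_empty ℚ w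
  have hsub : (∅ : Set (κ ⊕ ι)) ⊆ Set.range Sum.inl := Set.empty_subset _
  set s₁ := h0.extend hsub
  have h1 : LinearIndepOn ℚ w s₁ := h0.linearIndepOn_extend hsub
  have hs₁ : s₁ ⊆ Set.range Sum.inl := h0.extend_subset hsub
  have hspan₁ (k : κ) : w (Sum.inl k) ∈ Submodule.span ℚ (w '' s₁) :=
    h0.image_subset_span_image_extend hsub ⟨_, ⟨k, rfl⟩, rfl⟩
  have he : w (Sum.inr e) ∉ Submodule.span ℚ (w '' s₁) := by
    intro hmem
    let φ : (ι → ℚ) →ₗ[ℚ] ℚ := Fintype.linearCombination ℚ a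
    have hφ : Submodule.span ℚ (w '' s₁) ≤ LinearMap.ker φ := by
      rw [Submodule.span_le]
      rintro _ ⟨x, hx, rfl⟩
      obtain ⟨k, rfl⟩ := hs₁ hx
      simpa [φ, Fintype.linearCombination_apply, hwl] using ha k
    have := hφ hmem
    rw [hwr] at this
    simp [φ, hae] at this
  have h2 : LinearIndepOn ℚ w (insert (Sum.inr e) s₁) := h1.insert he
  set s := h2.extend (Set.subset_univ _)
  have h3 : LinearIndepOn ℚ w s := h2.linearIndepOn_extend (Set.subset_univ _)
  have hs : insert (Sum.inr e) s₁ ⊆ s := h2.subset_extend (Set.subset_univ _)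
  have hspan : Submodule.span ℚ (w '' s) = ⊤ := by
    rw [h2.span_image_extend_eq_span_image, eq_top_iff, ← (Pi.basisFun ℚ ι).span_eq,
      Submodule.span_le]
    rintro _ ⟨j, rfl⟩
    exact Submodule.subset_span ⟨Sum.inr j, Set.mem_univ _, by rw [hwr, Pi.basisFun_apply]⟩
  let bas : Module.Basis s ℚ (ι → ℚ) := Module.Basis.mk (v := fun x : s => w x) h3 (by
    rw [← hspan, ← Set.image_eq_range])
  let σ : ι ≃ s := (Pi.basisFun ℚ ι).indexEquiv bas
  let N : Matrix ι ι ℤ := Matrix.of fun i => wZ (σ i)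
  have hdet : N.det ≠ 0 := by
    intro hzero
    have hli : LinearIndependent ℚ (N.map (Int.castRingHom ℚ)).row :=
      (show LinearIndependent ℚ (fun x : s => w x) from h3).comp σ σ.injective
    rw [Matrix.linearIndependent_rows_iff_isUnit, Matrix.isUnit_iff_isUnit_det,
      ← RingHom.mapMatrix_apply, ← RingHom.map_det, hzero] at hli
    simp at hli
  let i₀ : ι := σ.symm ⟨Sum.inr e, hs (Set.mem_insert _ _)⟩
  let b (j : ι) : ℤ := N.adjugate j i₀
  have hb (i : ι) : ∑ j, wZ (σ i) j * b j = if i = i₀ then N.det else 0 := by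
    have := congrFun (congrFun N.mul_adjugate i) i₀
    simpa [Matrix.mul_apply, Matrix.one_apply, N, b] using this
  refine ⟨b, fun k => ?_, ?_, fun i => ?_⟩
  · let ψ : (ι → ℚ) →ₗ[ℚ] ℚ := Fintype.linearCombination ℚ fun j => (b j : ℚ)
    have hψ : Submodule.span ℚ (w '' s₁) ≤ LinearMap.ker ψ := by
      rw [Submodule.span_le]
      rintro _ ⟨x, hx, rfl⟩
      have h4 := hb (σ.symm ⟨x, hs (Set.mem_insert_of_mem _ hx)⟩)
      rw [if_neg, Equiv.apply_symm_apply] at h4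
      · have : ψ (w x) = ((∑ j, wZ x j * b j : ℤ) : ℚ) := by
          simp [ψ, Fintype.linearCombination_apply, w]
        rw [SetLike.mem_coe, LinearMap.mem_ker, this, h4, Int.cast_zero]
      · intro h5
        obtain ⟨k', hk'⟩ := hs₁ hx
        have h6 : x = Sum.inr e := congrArg Subtype.val (σ.symm.injective h5)
        exact Sum.inl_ne_inr (hk'.trans h6)
    have := hψ (hspan₁ k)
    rw [LinearMap.mem_ker, hwl, Fintype.linearCombination_apply] at this
    simp only [smul_eq_mul] at this
    exact_mod_cast this
  · have := hb i₀
    rw [if_pos rfl, Equiv.apply_symm_apply] at this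
    simp only [wZ, Sum.elim_inr, Pi.single_apply, ite_mul, one_mul, zero_mul, Finset.sum_ite_eq',
      Finset.mem_univ, if_true] at this
    rwa [this]
  · have := Matrix.det_le (A := N.updateRow i₀ (Pi.single i 1)) (abv := AbsoluteValue.abs) (x := A)
      (fun j k => by
        rw [AbsoluteValue.abs_apply, Matrix.updateRow_apply]
        split_ifs
        · rw [Pi.single_apply]; split_ifs <;> simp <;> omega
        · exact hwA _ _)
    rw [← Matrix.adjugate_apply, nsmul_eq_mul] at this
    exact this
/-- The exponents `(i, j)` of the monomials `X ^ i * Y ^ j` of total degree at most `D`. -/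
def triangle (D : ℕ) : Finset (ℕ × ℕ) :=
  (Finset.range (D + 1) ×ˢ Finset.range (D + 1)).filter fun p => p.1 + p.2 ≤ D

theorem mem_triangle {D : ℕ} {p : ℕ × ℕ} : p ∈ triangle D ↔ p.1 + p.2 ≤ D := by
  simp only [triangle, Finset.mem_filter, Finset.mem_product, Finset.mem_range]
  omega

/-- The bivariate polynomial of total degree at most `D` with the given coefficients. -/
noncomputable def ofTriangle {R : Type*} [CommRing R] {D : ℕ} (b : triangle D → R) : R[X][X] :=
  ∑ p, monomial p.1.2 (monomial p.1.1 (b p))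

theorem coeff_coeff_ofTriangle {R : Type*} [CommRing R] {D : ℕ} (b : triangle D → R) (i j : ℕ) :
    ((ofTriangle b).coeff j).coeff i = if h : (i, j) ∈ triangle D then b ⟨(i, j), h⟩ else 0 := by
  have h1 (p : triangle D) : ((monomial p.1.2 (monomial p.1.1 (b p))).coeff j).coeff i =
      if p.1 = (i, j) then b p else 0 := by
    rw [coeff_monomial]
    by_cases h2 : p.1.2 = j
    · rw [if_pos h2, coeff_monomial]
      simp [Prod.ext_iff, h2]
    · rw [if_neg h2, if_neg (by simp [Prod.ext_iff, h2]), coeff_zero]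
  simp only [ofTriangle, finsetSum_coeff, h1]
  split_ifs with h
  · rw [Finset.sum_eq_single ⟨(i, j), h⟩]
    · simp
    · intro p _ hp
      exact if_neg fun h' => hp (Subtype.ext h')
    · simp
  · refine Finset.sum_eq_zero fun p _ => if_neg fun (h' : p.1 = (i, j)) => h (h' ▸ p.2)

theorem evalEval_ofTriangle {R : Type*} [CommRing R] {D : ℕ} (b : triangle D → R) (x y : R) :
    (ofTriangle b).evalEval x y = ∑ p, x ^ p.1.1 * y ^ p.1.2 * b p := by
  simp only [ofTriangle, evalEval, eval_finsetSum, eval_monomial, eval_mul, eval_pow, eval_C]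
  exact Finset.sum_congr rfl fun p _ => by ring

theorem evalEval_derivative_ofTriangle {R : Type*} [CommRing R] {D : ℕ} (b : triangle D → R)
    (x y : R) : (ofTriangle b).derivative.evalEval x y =
      ∑ p, x ^ p.1.1 * (p.1.2 * y ^ (p.1.2 - 1)) * b p := by
  simp only [ofTriangle, evalEval, derivative_sum, derivative_monomial, eval_finsetSum,
    eval_monomial, eval_mul, eval_pow, eval_C, eval_natCast]
  exact Finset.sum_congr rfl fun p _ => by ring

theorem isPlaneCurve_ofTriangle {R : Type*} [CommRing R] {D : ℕ} {b : triangle D → R}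
    (hb : b ⟨(0, D), mem_triangle.mpr (zero_add D).le⟩ ≠ 0) : IsPlaneCurve D (ofTriangle b) where
  natDegree_coeff_le j := by
    refine natDegree_le_iff_coeff_eq_zero.mpr fun i hi => ?_
    rw [coeff_coeff_ofTriangle, dif_neg]
    rw [mem_triangle]
    dsimp only
    omega
  natDegree_le := by
    refine natDegree_le_iff_coeff_eq_zero.mpr fun j hj => ?_
    ext i
    rw [coeff_coeff_ofTriangle, dif_neg, coeff_zero]
    rw [mem_triangle]
    dsimp only
    omega
  coeff_ne_zero := by
    intro h
    apply hb
    rw [← coeff_zero (R := R) 0, ← h, coeff_coeff_ofTriangle, dif_pos]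

theorem IsPlaneCurve.eq_ofTriangle {R : Type*} [CommRing R] {D : ℕ} {g : R[X][X]}
    (hg : IsPlaneCurve D g) :
    g = ofTriangle fun p : triangle D => (g.coeff p.1.2).coeff p.1.1 := by
  ext j i
  rw [coeff_coeff_ofTriangle]
  split_ifs with h
  · rfl
  · rw [mem_triangle] at h
    by_cases hj : D < j
    · rw [coeff_eq_zero_of_natDegree_lt (hg.natDegree_le.trans_lt hj), coeff_zero]
    · refine coeff_eq_zero_of_natDegree_lt ((hg.natDegree_coeff_le j).trans_lt ?_)
      dsimp only at h
      omega

/-- Integer points in a box on a plane curve also lie on an integral plane curve of the same type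
whose height is polynomially bounded in the size of the box. -/
theorem exists_small_plane_curve (D : ℕ) : ∃ K k : ℕ, ∀ B : ℕ, 1 ≤ B → ∀ S : Finset (ℤ × ℤ),
    (∀ P ∈ S, (0 ≤ P.1 ∧ P.1 ≤ B) ∧ (0 ≤ P.2 ∧ P.2 ≤ B)) → ∀ g : ℚ[X][X], IsPlaneCurve D g →
    (∀ P ∈ S, g.evalEval (P.1 : ℚ) (P.2 : ℚ) = 0) →
    ∃ G : ℤ[X][X], IsPlaneCurve D G ∧ (∀ P ∈ S, G.evalEval P.1 P.2 = 0) ∧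
      ∀ P ∈ S, |G.derivative.evalEval P.1 P.2| ≤ K * (B : ℤ) ^ k := by
  set N := Fintype.card (triangle D)
  refine ⟨N * (D * N.factorial), 2 * D + D * N, fun B hB S hbox g hg hS => ?_⟩
  have hB' : (1 : ℤ) ≤ B := by exact_mod_cast hB
  have hpow {x : ℤ} (h0 : 0 ≤ x) (h1 : x ≤ B) {i : ℕ} (hi : i ≤ D) : |x ^ i| ≤ (B : ℤ) ^ D := by
    rw [abs_of_nonneg (pow_nonneg h0 _)]
    exact (pow_le_pow_left₀ h0 h1 _).trans (pow_le_pow_right₀ hB' hi)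
  obtain ⟨b, hb0, hbe, hbA⟩ := exists_bounded_int_solution
    (⟨(0, D), mem_triangle.mpr (zero_add D).le⟩ : triangle D)
    (fun (P : S) (p : triangle D) => P.1.1 ^ p.1.1 * P.1.2 ^ p.1.2)
    (A := (B : ℤ) ^ D) (one_le_pow₀ hB') (fun P p => by
      obtain ⟨⟨h1, h2⟩, h3, h4⟩ := hbox P P.2
      have hp := mem_triangle.mp p.2
      rw [abs_of_nonneg (mul_nonneg (pow_nonneg h1 _) (pow_nonneg h3 _))]
      calc P.1.1 ^ p.1.1 * P.1.2 ^ p.1.2 ≤ (B : ℤ) ^ p.1.1 * (B : ℤ) ^ p.1.2 := by gcongr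
        _ = (B : ℤ) ^ (p.1.1 + p.1.2) := (pow_add _ _ _).symm
        _ ≤ (B : ℤ) ^ D := pow_le_pow_right₀ hB' hp)
    (fun p => (g.coeff p.1.2).coeff p.1.1) (fun P => by
      have := hS P P.2
      rw [hg.eq_ofTriangle, evalEval_ofTriangle] at this
      push_cast
      exact this) (by
      obtain ⟨c, hc, h⟩ := hg.exists_coeff_eq_C
      simpa [h] using hc)
  refine ⟨ofTriangle b, isPlaneCurve_ofTriangle hbe, fun P hP => ?_, fun P hP => ?_⟩
  · rw [evalEval_ofTriangle]
    exact hb0 ⟨P, hP⟩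
  · rw [evalEval_derivative_ofTriangle]
    refine (Finset.abs_sum_le_sum_abs _ _).trans ?_
    obtain ⟨⟨h1, h2⟩, h3, h4⟩ := hbox P hP
    have : ∀ p ∈ (Finset.univ : Finset (triangle D)),
        |P.1 ^ p.1.1 * (p.1.2 * P.2 ^ (p.1.2 - 1)) * b p| ≤
        (B : ℤ) ^ D * (D * (B : ℤ) ^ D) * (N.factorial * ((B : ℤ) ^ D) ^ N) := by
      intro p _
      have hp := mem_triangle.mp p.2
      rw [abs_mul, abs_mul, abs_mul]
      have e1 := hpow h1 h2 (i := p.1.1) (by omega)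
      have e2 := hpow h3 h4 (i := p.1.2 - 1) (by omega)
      have e3 : |(p.1.2 : ℤ)| ≤ D := by rw [Nat.abs_cast]; exact_mod_cast (by omega)
      have e4 := hbA p
      gcongr
    refine (Finset.sum_le_card_nsmul _ _ _ this).trans (le_of_eq ?_)
    rw [nsmul_eq_mul, Finset.card_univ]
    push_cast
    ring

/-- There are many primes of a given order of magnitude. -/
theorem exists_primes_Ioc (r : ℕ) {m : ℕ} (hm : 1 ≤ m) :
    ∃ s : Finset ℕ, s.card = r ∧ ∀ p ∈ s, p.Prime ∧ m < p ∧ p ≤ 2 ^ r * m := by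
  induction r with
  | zero => exact ⟨∅, by simp⟩
  | succ r ih =>
    obtain ⟨s, hs, h⟩ := ih
    obtain ⟨p, hp, h1, h2⟩ := Nat.exists_prime_lt_and_le_two_mul (2 ^ r * m) (by positivity)
    have hps : p ∉ s := fun hps => (h p hps).2.2.not_gt h1
    refine ⟨insert p s, by rw [Finset.card_insert_of_notMem hps, hs], fun p' hp' => ?_⟩
    rcases Finset.mem_insert.mp hp' with rfl | hp'
    · refine ⟨hp, lt_of_le_of_lt ?_ h1, by rw [pow_succ]; linarith⟩
      exact Nat.le_mul_of_pos_left m (by positivity)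
    · obtain ⟨h3, h4, h5⟩ := h p' hp'
      refine ⟨h3, h4, h5.trans ?_⟩
      rw [pow_succ]
      nlinarith

theorem exists_prime_not_dvd {s : Finset ℕ} {m : ℕ} (hs : ∀ p ∈ s, p.Prime ∧ m < p)
    {d : ℤ} (hd : d ≠ 0) (hlt : |d| < (m : ℤ) ^ s.card) : ∃ p ∈ s, ¬ (p : ℤ) ∣ d := by
  by_contra! hcon
  have h1 : ∏ p ∈ s, p ∣ d.natAbs :=
    Finset.prod_primes_dvd _ (fun p hp => (hs p hp).1.prime)
      fun p hp => Int.natCast_dvd.mp (hcon p hp)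
  have h2 := Nat.le_of_dvd (Int.natAbs_pos.mpr hd) h1
  have h3 : m ^ s.card ≤ ∏ p ∈ s, p := Finset.pow_card_le_prod _ _ _ fun p hp => (hs p hp).2.le
  rw [Int.abs_eq_natAbs] at hlt
  have : d.natAbs < m ^ s.card := by exact_mod_cast hlt
  omega

/-- The numerical inequality that makes the determinant method work. -/
theorem determinant_inequality {M B p : ℕ} {ε : ℝ} (hM : 2 ≤ M) (hB : 1 ≤ B)
    (hε : 1 / 2 ≤ ε * (2 * M - 1)) (hp : 2 * M * (B : ℝ) ^ (1 / 2 + ε) < p) :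
    (2 * M) ^ (2 * M) * B ^ (M ^ 2) < p ^ (M * (2 * M - 1)) := by
  have hB' : (1 : ℝ) ≤ B := by exact_mod_cast hB
  have hM' : (2 : ℝ) ≤ M := by exact_mod_cast hM
  have hMsub : ((2 * M - 1 : ℕ) : ℝ) = 2 * M - 1 := by
    rw [Nat.cast_sub (by omega)]
    push_cast
    ring
  have hne : M * (2 * M - 1) ≠ 0 := Nat.mul_ne_zero (by omega) (by omega)
  have h1 : (2 * M * (B : ℝ) ^ (1 / 2 + ε)) ^ (M * (2 * M - 1)) < (p : ℝ) ^ (M * (2 * M - 1)) :=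
    pow_lt_pow_left₀ hp (by positivity) hne
  have h2 : ((2 * M : ℝ)) ^ (2 * M) ≤ (2 * M) ^ (M * (2 * M - 1)) := by
    refine pow_le_pow_right₀ (by linarith) ?_
    rw [mul_comm 2 M]
    exact Nat.mul_le_mul_left _ (by omega)
  have h3 : (B : ℝ) ^ (M ^ 2) ≤ ((B : ℝ) ^ (1 / 2 + ε)) ^ (M * (2 * M - 1)) := by
    rw [← Real.rpow_natCast (_ ^ _), ← Real.rpow_mul (by linarith), ← Real.rpow_natCast]
    refine Real.rpow_le_rpow_of_exponent_le hB' ?_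
    push_cast
    rw [hMsub]
    nlinarith
  have h4 : ((2 * M : ℝ)) ^ (2 * M) * (B : ℝ) ^ (M ^ 2) < (p : ℝ) ^ (M * (2 * M - 1)) := by
    refine lt_of_le_of_lt ?_ h1
    rw [mul_pow (2 * (M : ℝ))]
    gcongr
  exact_mod_cast h4

theorem exists_linear_cover_smooth (D : ℕ) {ε : ℝ} (hε : 0 < ε) (K k : ℕ) : ∃ C : ℝ, 0 ≤ C ∧
    ∀ B : ℕ, 1 ≤ B → ∀ S : Finset (ℤ × ℤ),
    (∀ P ∈ S, (0 ≤ P.1 ∧ P.1 ≤ B) ∧ (0 ≤ P.2 ∧ P.2 ≤ B)) → ∀ g : ℤ[X][X], IsPlaneCurve D g →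
    (∀ P ∈ S, g.evalEval P.1 P.2 = 0) →
    (∀ P ∈ S, |g.derivative.evalEval P.1 P.2| ≤ K * (B : ℤ) ^ k) →
    (∀ P ∈ S, g.derivative.evalEval P.1 P.2 ≠ 0) →
    (∀ P ∈ S, ∀ r ∈ rationalRoots g, r.eval (P.1 : ℚ) ≠ P.2) →
    (S.card : ℝ) ≤ C * (B : ℝ) ^ (1 / 2 + ε) := by
  obtain ⟨M₀, hM₀⟩ := exists_nat_gt (1 / ε)
  set M := M₀ + 2
  have hM : 2 ≤ M := by omega
  have hM' : (2 : ℝ) ≤ M := by exact_mod_cast hM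
  have hMε : 1 / 2 ≤ ε * (2 * M - 1) := by
    have h1 : 1 < M₀ * ε := by rwa [div_lt_iff₀ hε] at hM₀
    have h2 : (M : ℝ) = M₀ + 2 := by simp [M]
    rw [h2]
    nlinarith
  set r := 2 * k + K
  set A := D * (D + D * M + M)
  refine ⟨r * (A * (D * (2 ^ r * (2 * M + 1)))), by positivity,
    fun B hB S hbox g hg hS hsmall hne hroot => ?_⟩
  have hB' : (1 : ℝ) ≤ B := by exact_mod_cast hB
  set x := (B : ℝ) ^ (1 / 2 + ε) with hx
  have hx1 : 1 ≤ x := Real.one_le_rpow hB' (by linarith)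
  set m := ⌈2 * M * x⌉₊ with hm
  have hm0 : 2 * M * x ≤ m := Nat.le_ceil _
  have hm1 : (m : ℝ) ≤ (2 * M + 1) * x := by
    have := (Nat.ceil_lt_add_one (show 0 ≤ 2 * M * x by positivity)).le
    linarith
  have hmpos : 1 ≤ m := by
    have : (1 : ℝ) ≤ m := by nlinarith
    exact_mod_cast this
  obtain ⟨s, hs, hsp⟩ := exists_primes_Ioc r hmpos
  have hmr : (K : ℤ) * (B : ℤ) ^ k < (m : ℤ) ^ s.card := by
    have hsqrt : (B : ℝ) ≤ x ^ 2 := by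
      rw [← Real.rpow_natCast, hx, ← Real.rpow_mul (by linarith)]
      conv_lhs => rw [← Real.rpow_one (B : ℝ)]
      refine Real.rpow_le_rpow_of_exponent_le hB' ?_
      push_cast
      linarith
    have h2m : 2 * x ≤ m := by nlinarith
    have h1 : (K : ℝ) * (B : ℝ) ^ k < (m : ℝ) ^ s.card := by
      rw [hs]
      calc (K : ℝ) * (B : ℝ) ^ k < 2 ^ K * (x ^ 2) ^ k := by
            have : (K : ℝ) < 2 ^ K := by exact_mod_cast Nat.lt_two_pow_self
            have h3 : (B : ℝ) ^ k ≤ (x ^ 2) ^ k := by gcongr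
            have h4 : (0 : ℝ) < (B : ℝ) ^ k := by positivity
            calc _ < 2 ^ K * (B : ℝ) ^ k := by gcongr
              _ ≤ _ := by gcongr
        _ ≤ 2 ^ r * x ^ r := by
            rw [← pow_mul]
            gcongr
            · norm_num
            · omega
            · omega
        _ = (2 * x) ^ r := (mul_pow _ _ _).symm
        _ ≤ (m : ℝ) ^ r := by gcongr
    exact_mod_cast h1
  have hcover : S ⊆ s.biUnion fun p => S.filter fun P =>
      ¬ (p : ℤ) ∣ g.derivative.evalEval P.1 P.2 := by
    intro P hP
    obtain ⟨p, hp, hpd⟩ := exists_prime_not_dvd (fun p hp => ⟨(hsp p hp).1, (hsp p hp).2.1⟩)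
      (hne P hP) ((hsmall P hP).trans_lt hmr)
    exact Finset.mem_biUnion.mpr ⟨p, hp, Finset.mem_filter.mpr ⟨hP, hpd⟩⟩
  have hcard : S.card ≤ s.card * (A * (D * (2 ^ r * m))) := by
    refine (Finset.card_le_card hcover).trans (Finset.card_biUnion_le_card_mul _ _ _ ?_)
    intro p hp
    obtain ⟨hp1, hp2, hp3⟩ := hsp p hp
    have hsub : S.filter (fun P => ¬ (p : ℤ) ∣ g.derivative.evalEval P.1 P.2) ⊆ S :=
      Finset.filter_subset _ _
    refine (card_smooth_points_le hg hp1 (by omega) hB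
      (determinant_inequality hM hB hMε (hm0.trans_lt (by exact_mod_cast hp2))) _
      (fun P hP => hS P (hsub hP)) (fun P hP => hbox P (hsub hP))
      (fun P hP => (Finset.mem_filter.mp hP).2) (fun P hP => hroot P (hsub hP))).trans ?_
    gcongr
  rw [hs] at hcard
  calc (S.card : ℝ) ≤ (r * (A * (D * (2 ^ r * m))) : ℕ) := by exact_mod_cast hcard
    _ = r * (A * (D * (2 ^ r * (m : ℝ)))) := by push_cast; ring
    _ ≤ r * (A * (D * (2 ^ r * ((2 * M + 1) * x)))) := by gcongr
    _ = _ := by ring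

/-- Apart from the points on boundedly many lines, a plane curve has `O(B ^ (1 / 2 + ε))` integer
points in a square of side `B`, uniformly in the curve. -/
theorem exists_linear_cover (D : ℕ) {ε : ℝ} (hε : 0 < ε) : ∃ N : ℕ, ∃ C : ℝ, 0 ≤ C ∧
    ∀ B : ℕ, 1 ≤ B → ∀ S : Finset (ℤ × ℤ),
    (∀ P ∈ S, (0 ≤ P.1 ∧ P.1 ≤ B) ∧ (0 ≤ P.2 ∧ P.2 ≤ B)) → ∀ g : ℚ[X][X], IsPlaneCurve D g →
    (∀ P ∈ S, g.evalEval (P.1 : ℚ) (P.2 : ℚ) = 0) →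
    ∃ Λ : Finset ℚ[X], Λ.card ≤ N ∧ (∀ r ∈ Λ, r.natDegree ≤ 1) ∧
      ((S.filter fun P => ∀ r ∈ Λ, r.eval (P.1 : ℚ) ≠ P.2).card : ℝ) ≤
        C * (B : ℝ) ^ (1 / 2 + ε) := by
  induction D with
  | zero =>
    refine ⟨0, 0, le_rfl, fun B hB S hbox g hg hS => ⟨∅, by simp, by simp, ?_⟩⟩
    obtain ⟨c, hc, h⟩ := hg.exists_coeff_eq_C
    have hg0 : g = C (C c) := by rw [← h]; exact eq_C_of_natDegree_le_zero hg.natDegree_le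
    have : S = ∅ := Finset.eq_empty_of_forall_notMem fun P hP => hc (by
      simpa [hg0, evalEval] using hS P hP)
    simp [this]
  | succ D ih =>
    obtain ⟨N, C₀, hC₀, hcov⟩ := ih
    obtain ⟨K, k, hsmall⟩ := exists_small_plane_curve (D + 1)
    obtain ⟨C₁, hC₁, hsmooth⟩ := exists_linear_cover_smooth (D + 1) hε K k
    refine ⟨N + (D + 1), C₀ + C₁, by positivity, fun B hB S hbox g hg hS => ?_⟩
    obtain ⟨G, hG, hGS, hGsmall⟩ := hsmall B hB S hbox g hg hS
    set S₀ := S.filter fun P => G.derivative.evalEval P.1 P.2 = 0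
    have hS₀ : S₀ ⊆ S := Finset.filter_subset _ _
    obtain ⟨Λ₀, hΛ₀, hΛdeg, hΛ⟩ := hcov B hB S₀ (fun P hP => hbox P (hS₀ hP)) _
      (hG.derivative.map (f := Int.castRingHom ℚ) Int.cast_injective) (fun P hP => by
        have := intCast_evalEval (R := ℚ) G.derivative P.1 P.2
        rw [← this, (Finset.mem_filter.mp hP).2, Int.cast_zero])
    have : DecidableEq ℚ[X] := Classical.decEq _
    refine ⟨Λ₀ ∪ rationalRoots G, (Finset.card_union_le _ _).trans
      (add_le_add hΛ₀ hG.card_rationalRoots_le), fun r hr => ?_, ?_⟩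
    · rcases Finset.mem_union.mp hr with hr | hr
      · exact hΛdeg r hr
      · exact (hG.map (f := Int.castRingHom ℚ) Int.cast_injective).natDegree_root_le_one
          (hG.mem_rationalRoots.mp hr)
    · set S₁ := S.filter fun P => G.derivative.evalEval P.1 P.2 ≠ 0 ∧
        ∀ r ∈ rationalRoots G, r.eval (P.1 : ℚ) ≠ P.2
      have hS₁ : S₁ ⊆ S := Finset.filter_subset _ _
      have h1 := hsmooth B hB S₁ (fun P hP => hbox P (hS₁ hP)) G hG (fun P hP => hGS P (hS₁ hP))
        (fun P hP => hGsmall P (hS₁ hP)) (fun P hP => (Finset.mem_filter.mp hP).2.1)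
        (fun P hP => (Finset.mem_filter.mp hP).2.2)
      have h2 : (S.filter fun P => ∀ r ∈ Λ₀ ∪ rationalRoots G, r.eval (P.1 : ℚ) ≠ P.2) ⊆
          (S₀.filter fun P => ∀ r ∈ Λ₀, r.eval (P.1 : ℚ) ≠ P.2) ∪ S₁ := by
        intro P hP
        obtain ⟨hPS, hPr⟩ := Finset.mem_filter.mp hP
        by_cases h0 : G.derivative.evalEval P.1 P.2 = 0
        · exact Finset.mem_union_left _ (Finset.mem_filter.mpr
            ⟨Finset.mem_filter.mpr ⟨hPS, h0⟩, fun r hr => hPr r (Finset.mem_union_left _ hr)⟩)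
        · exact Finset.mem_union_right _ (Finset.mem_filter.mpr
            ⟨hPS, h0, fun r hr => hPr r (Finset.mem_union_right _ hr)⟩)
      have h3 := (Finset.card_le_card h2).trans (Finset.card_union_le _ _)
      have h4 : ((S.filter fun P => ∀ r ∈ Λ₀ ∪ rationalRoots G, r.eval (P.1 : ℚ) ≠ P.2).card : ℝ) ≤
          (S₀.filter fun P => ∀ r ∈ Λ₀, r.eval (P.1 : ℚ) ≠ P.2).card + S₁.card := by
        exact_mod_cast h3
      refine h4.trans ?_
      rw [add_mul]
      exact add_le_add hΛ h1

end PlaneCurves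

section MultiAffine

open Function

/-- `F` depends only on the coordinates in `T`, and is affine in each of them separately. -/
structure IsMultiAffine {σ : Type*} [DecidableEq σ] (T : Finset σ) (F : (σ → ℤ) → ℚ) : Prop where
  update_eq : ∀ i ∉ T, ∀ x t, F (update x i t) = F x
  affine : ∀ i x, ∃ α β : ℚ, ∀ t : ℤ, F (update x i t) = α + β * t

namespace IsMultiAffine

variable {σ : Type*} [DecidableEq σ] {T : Finset σ} {F F' : (σ → ℤ) → ℚ}

theorem sub (h : IsMultiAffine T F) (h' : IsMultiAffine T F') :
    IsMultiAffine T fun x => F x - F' x where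
  update_eq i hi x t := by rw [h.update_eq i hi, h'.update_eq i hi]
  affine i x := by
    obtain ⟨α, β, hF⟩ := h.affine i x
    obtain ⟨α', β', hF'⟩ := h'.affine i x
    exact ⟨α - α', β - β', fun t => by rw [hF, hF']; ring⟩

theorem const_mul (c : ℚ) (h : IsMultiAffine T F) : IsMultiAffine T fun x => c * F x where
  update_eq i hi x t := by rw [h.update_eq i hi]
  affine i x := by
    obtain ⟨α, β, hF⟩ := h.affine i x
    exact ⟨c * α, c * β, fun t => by rw [hF]; ring⟩

theorem restrict (h : IsMultiAffine T F) (i : σ) (s : ℤ) :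
    IsMultiAffine (T.erase i) fun x => F (update x i s) where
  update_eq j hj x t := by
    by_cases hji : j = i
    · rw [hji, update_idem]
    · rw [update_comm hji, h.update_eq j fun hjT => hj (Finset.mem_erase.mpr ⟨hji, hjT⟩)]
  affine j x := by
    by_cases hji : j = i
    · exact ⟨F (update x i s), 0, fun t => by rw [hji, update_idem]; ring⟩
    · obtain ⟨α, β, hF⟩ := h.affine j (update x i s)
      exact ⟨α, β, fun t => by rw [update_comm hji, hF]⟩

theorem add_coord_mul {k : σ} (hk : k ∈ T) (h : IsMultiAffine (T.erase k) F)
    (h' : IsMultiAffine (T.erase k) F') : IsMultiAffine T fun x => F x + x k * F' x where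
  update_eq i hi x t := by
    have hi' : i ∉ T.erase k := fun h => hi (Finset.mem_of_mem_erase h)
    have hki : k ≠ i := fun h => hi (h ▸ hk)
    rw [h.update_eq i hi', h'.update_eq i hi', update_of_ne hki]
  affine i x := by
    by_cases hki : k = i
    · subst hki
      refine ⟨F x, F' x, fun t => ?_⟩
      rw [h.update_eq k (Finset.notMem_erase _ _), h'.update_eq k (Finset.notMem_erase _ _),
        update_self, mul_comm]
    · obtain ⟨α, β, hF⟩ := h.affine i x
      obtain ⟨α', β', hF'⟩ := h'.affine i x
      refine ⟨α + x k * α', β + x k * β', fun t => ?_⟩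
      rw [hF, hF', update_of_ne hki]
      ring

theorem eq_interpolation (h : IsMultiAffine T F) (k : σ) {s₀ s₁ : ℤ} (hs : s₀ ≠ s₁) (x : σ → ℤ) :
    F x = F (update x k s₀) +
      (x k - s₀) / (s₁ - s₀) * (F (update x k s₁) - F (update x k s₀)) := by
  obtain ⟨α, β, hF⟩ := h.affine k x
  have hs' : (s₁ : ℚ) - s₀ ≠ 0 := sub_ne_zero.mpr (by exact_mod_cast hs.symm)
  have h1 := hF (x k)
  rw [update_eq_self] at h1
  rw [h1, hF, hF]
  field_simp
  ring

theorem interpolation {k : σ} (hk : k ∈ T) (h : IsMultiAffine (T.erase k) F)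
    (h' : IsMultiAffine (T.erase k) F') (s₀ s₁ : ℤ) :
    IsMultiAffine T fun x => F x + (x k - s₀) / (s₁ - s₀) * (F' x - F x) := by
  have h1 := (h'.sub h).const_mul ((s₁ - s₀ : ℚ)⁻¹)
  have h2 := add_coord_mul hk (h.sub (h1.const_mul s₀)) h1
  refine cast (congrArg _ (funext fun x => ?_)) h2
  rw [div_eq_mul_inv]
  ring

theorem congr_of_eqOn [Fintype σ] (h : IsMultiAffine T F) {x y : σ → ℤ}
    (hxy : ∀ i ∈ T, x i = y i) : F x = F y := by
  have key (s : Finset σ) : F (s.piecewise x y) = F y := by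
    induction s using Finset.induction_on with
    | empty => rw [Finset.piecewise_empty]
    | insert j s hj ih =>
      rw [Finset.piecewise_insert]
      by_cases hjT : j ∈ T
      · rw [hxy j hjT, ← Finset.piecewise_eq_of_notMem s x y hj, update_eq_self, ih]
      · rw [h.update_eq j hjT, ih]
  rw [← key Finset.univ, Finset.piecewise_univ]

theorem exists_ne_zero [Fintype σ] (A : Finset ((σ → ℤ) → ℚ)) (hA : ∀ F ∈ A, IsMultiAffine T F)
    (hA0 : ∀ F ∈ A, ∃ x, F x ≠ 0) : ∃ x, ∀ F ∈ A, F x ≠ 0 := by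
  classical
  induction T using Finset.induction_on generalizing A with
  | empty =>
    refine ⟨0, fun F hF => ?_⟩
    obtain ⟨x, hx⟩ := hA0 F hF
    rwa [(hA F hF).congr_of_eqOn (y := x) fun i hi => absurd hi (Finset.notMem_empty i)]
  | insert i T hi ih =>
    have hH : ∀ F ∈ A, ∃ s : ℤ, ∃ x, F (update x i s) ≠ 0 := fun F hF => by
      obtain ⟨x, hx⟩ := hA0 F hF
      exact ⟨x i, x, by rwa [update_eq_self]⟩
    choose! s hs using hH
    obtain ⟨x, hx⟩ := ih (A.image fun F x => F (update x i (s F))) (fun H hH => by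
        obtain ⟨F, hF, rfl⟩ := Finset.mem_image.mp hH
        have := (hA F hF).restrict i (s F)
        rwa [Finset.erase_insert hi] at this) (fun H hH => by
        obtain ⟨F, hF, rfl⟩ := Finset.mem_image.mp hH
        exact hs F hF)
    have hfin : (⋃ F ∈ A, {t : ℤ | F (update x i t) = 0}).Finite := by
      refine A.finite_toSet.biUnion fun F hF => Set.Subsingleton.finite ?_
      intro t ht t' ht'
      by_contra hne
      have h1 := (hA F hF).eq_interpolation i hne (update x i (s F))
      simp only [update_idem] at h1
      rw [Set.mem_ofPred_eq.mp ht, Set.mem_ofPred_eq.mp ht'] at h1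
      refine hx _ (Finset.mem_image_of_mem _ hF) ?_
      simpa using h1
    obtain ⟨t, ht⟩ := hfin.infinite_compl.nonempty
    refine ⟨update x i t, fun F hF h0 => ht ?_⟩
    simp only [Set.mem_iUnion]
    exact ⟨F, hF, h0⟩

end IsMultiAffine

/-- The box of side `B` with corner `c` in the coordinates `T`, with the others fixed to be `z`. -/
noncomputable def coordBox {σ : Type*} [DecidableEq σ] [Fintype σ] (z c : σ → ℤ)
    (T : Finset σ) (B : ℕ) :
    Finset (σ → ℤ) :=
  Fintype.piFinset fun l => if l ∈ T then Finset.Icc (c l) (c l + B) else {z l}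

section coordBox

variable {σ : Type*} [DecidableEq σ] [Fintype σ] {z c x : σ → ℤ} {T : Finset σ} {B : ℕ}

theorem mem_coordBox : x ∈ coordBox z c T B ↔
    (∀ l ∈ T, c l ≤ x l ∧ x l ≤ c l + B) ∧ ∀ l ∉ T, x l = z l := by
  rw [coordBox, Fintype.mem_piFinset]
  refine ⟨fun h => ⟨fun l hl => ?_, fun l hl => ?_⟩, fun h l => ?_⟩
  · simpa [hl] using h l
  · simpa [hl] using h l
  · by_cases hl : l ∈ T
    · simpa [hl] using h.1 l hl
    · simpa [hl] using h.2 l hl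

theorem card_coordBox : (coordBox z c T B).card = (B + 1) ^ T.card := by
  rw [coordBox, Fintype.card_piFinset]
  have h (l : σ) : (if l ∈ T then Finset.Icc (c l) (c l + B) else {z l}).card =
      if l ∈ T then B + 1 else 1 := by
    split_ifs
    · rw [Int.card_Icc]
      omega
    · rfl
  simp [h, Finset.prod_ite_mem]

theorem update_mem_coordBox (hx : x ∈ coordBox z c T B) (i : σ) (t : ℤ) :
    update x i t ∈ coordBox (update z i t) c (T.erase i) B := by
  rw [mem_coordBox] at hx ⊢
  refine ⟨fun l hl => ?_, fun l hl => ?_⟩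
  · rw [update_of_ne (Finset.ne_of_mem_erase hl)]
    exact hx.1 l (Finset.mem_of_mem_erase hl)
  · by_cases hli : l = i
    · rw [hli, update_self, update_self]
    · rw [update_of_ne hli, update_of_ne hli]
      exact hx.2 l fun hlT => hl (Finset.mem_erase.mpr ⟨hli, hlT⟩)

theorem mem_coordBox_update (hx : x ∈ coordBox z c T B) (i : σ) :
    x ∈ coordBox (update z i (x i)) c (T.erase i) B := by
  have := update_mem_coordBox hx i (x i)
  rwa [update_eq_self] at this

theorem IsMultiAffine.card_zeros_le {F : (σ → ℤ) → ℚ} (hF : IsMultiAffine T F)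
    (hF0 : ∃ x, F x ≠ 0) (z c : σ → ℤ) (B : ℕ) :
    ((coordBox z c T B).filter fun x => F x = 0).card ≤ T.card * (B + 1) ^ (T.card - 1) := by
  induction T using Finset.induction_on generalizing F z with
  | empty =>
    obtain ⟨x₀, hx₀⟩ := hF0
    rw [Finset.filter_false_of_mem]
    · simp
    · intro x _
      rwa [hF.congr_of_eqOn (y := x₀) fun i hi => absurd hi (Finset.notMem_empty i)]
  | insert i T hi ih =>
    obtain ⟨x₀, hx₀⟩ := hF0
    let H : (σ → ℤ) → ℚ := fun x => F (update x i (x₀ i))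
    have hH : IsMultiAffine T H := by
      have := hF.restrict i (x₀ i)
      rwa [Finset.erase_insert hi] at this
    have hH0 : ∃ x, H x ≠ 0 := ⟨x₀, by simpa only [H, update_eq_self]⟩
    set Z := (coordBox z c (insert i T) B).filter fun x => F x = 0
    have hproj : ∀ x ∈ Z, update x i (z i) ∈ coordBox z c T B := fun x hx => by
      have := update_mem_coordBox (Finset.mem_filter.mp hx).1 i (z i)
      rwa [update_eq_self, Finset.erase_insert hi] at this
    have hHz (x : σ → ℤ) : H (update x i (z i)) = H x := by simp only [H, update_idem]
    have hinj {x x' : σ → ℤ} (h : update x i (z i) = update x' i (z i)) (h' : x i = x' i) :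
        x = x' := by
      rw [← update_eq_self i x, ← update_eq_self i x', ← h', ← update_idem (z i),
        ← update_idem (z i) _ x', h]
    have h1 : (Z.filter fun x => H x = 0).card ≤ (B + 1) * (T.card * (B + 1) ^ (T.card - 1)) := by
      refine (Finset.card_le_mul_card_image (f := fun x => update x i (z i)) _ (B + 1) ?_).trans
        (Nat.mul_le_mul_left _ ((Finset.card_le_card ?_).trans (ih hH hH0 z)))
      · intro w _
        have hB : (Finset.Icc (c i) (c i + B)).card = B + 1 := by
          rw [Int.card_Icc]
          omega
        rw [← hB]
        refine Finset.card_le_card_of_injOn (fun x => x i) (fun x hx => ?_) fun x hx x' hx' h => ?_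
        · have hx := (Finset.mem_filter.mp (Finset.mem_filter.mp hx).1).1
          exact Finset.mem_Icc.mpr ((mem_coordBox.mp (Finset.mem_filter.mp hx).1).1 i
            (Finset.mem_insert_self _ _))
        · exact hinj ((Finset.mem_filter.mp hx).2.trans (Finset.mem_filter.mp hx').2.symm) h
      · intro w hw
        obtain ⟨x, hx, rfl⟩ := Finset.mem_image.mp hw
        obtain ⟨hxZ, hx0⟩ := Finset.mem_filter.mp hx
        exact Finset.mem_filter.mpr ⟨hproj x hxZ, by rw [hHz, hx0]⟩
    have h2 : (Z.filter fun x => ¬ H x = 0).card ≤ (B + 1) ^ T.card := by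
      rw [← card_coordBox (z := z) (c := c)]
      refine Finset.card_le_card_of_injOn (fun x => update x i (z i))
        (fun x hx => hproj x (Finset.mem_filter.mp hx).1) fun x hx x' hx' h => ?_
      obtain ⟨hxZ, hxH⟩ := Finset.mem_filter.mp hx
      obtain ⟨hxZ', -⟩ := Finset.mem_filter.mp hx'
      have hx0 := (Finset.mem_filter.mp hxZ).2
      have hx0' := (Finset.mem_filter.mp hxZ').2
      refine hinj h (by_contra fun hne => hxH ?_)
      have h3 := hF.eq_interpolation i hne (update x i (x₀ i))
      have h4 : update x i (x' i) = x' := by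
        have := congrArg (fun w => update w i (x' i)) h
        simpa only [update_idem, update_eq_self] using this
      simp only [update_idem, update_eq_self, h4, hx0, hx0'] at h3
      simpa [H] using h3
    rw [← Finset.card_filter_add_card_filter_not (fun x => H x = 0)]
    refine (add_le_add h1 h2).trans ?_
    rw [Finset.card_insert_of_notMem hi, Nat.add_sub_cancel]
    rcases Nat.eq_zero_or_pos T.card with h0 | hpos
    · simp [h0]
    · obtain ⟨m, hm⟩ := Nat.exists_eq_succ_of_ne_zero hpos.ne'
      rw [hm, Nat.succ_sub_one, pow_succ]
      apply le_of_eq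
      ring

end coordBox

end MultiAffine

/-- The Kővári–Sós–Turán argument for a bipartite graph in which two vertices on the right with
different keys have at most `D` common neighbours. -/
theorem card_edges_sq_le {α β γ : Type*} [DecidableEq α] [DecidableEq β] [DecidableEq γ]
    (E : Finset (α × β)) {n D : ℕ} (hL : (E.image Prod.fst).card ≤ n)
    (hR : (E.image Prod.snd).card ≤ n) (key : β → γ)
    (hkey : ∀ s, ((E.image Prod.snd).filter fun r => key r = s).card ≤ D)
    (hcodeg : ∀ r r', key r ≠ key r' →
      ((E.image Prod.fst).filter fun l => (l, r) ∈ E ∧ (l, r') ∈ E).card ≤ D) :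
    E.card ^ 2 ≤ n * (2 * D * n ^ 2) := by
  set L := E.image Prod.fst
  set R := E.image Prod.snd
  have hELR : E ⊆ L ×ˢ R := fun e he => Finset.mem_product.mpr
    ⟨Finset.mem_image_of_mem _ he, Finset.mem_image_of_mem _ he⟩
  have hE : E.card ≤ n * n := by
    refine (Finset.card_le_card hELR).trans ?_
    rw [Finset.card_product]
    exact Nat.mul_le_mul hL hR
  let d (l : α) : Finset (α × β) := E.filter fun e => e.1 = l
  have h1 : E.card = ∑ l ∈ L, (d l).card :=
    Finset.card_eq_sum_card_fiberwise fun e he => Finset.mem_image_of_mem _ he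
  set Q := (E ×ˢ E).filter fun q => q.1.1 = q.2.1
  have h2 : ∑ l ∈ L, (d l).card ^ 2 = Q.card := by
    rw [Finset.card_eq_sum_card_fiberwise (f := fun q => q.1.1) (t := L)]
    · refine Finset.sum_congr rfl fun l _ => ?_
      rw [sq, ← Finset.card_product]
      congr 1
      ext ⟨e, e'⟩
      simp only [d, Q, Finset.mem_product, Finset.mem_filter]
      constructor
      · rintro ⟨⟨h, rfl⟩, h', h''⟩
        exact ⟨⟨⟨h, h'⟩, h''.symm⟩, rfl⟩
      · rintro ⟨⟨⟨h, h'⟩, h''⟩, rfl⟩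
        exact ⟨⟨h, rfl⟩, h', h''.symm⟩
    · intro q hq
      exact Finset.mem_image_of_mem _ (Finset.mem_product.mp (Finset.mem_filter.mp hq).1).1
  have h3 : (Q.filter fun q => key q.1.2 = key q.2.2).card ≤ D * (n * n) := by
    refine (Finset.card_le_mul_card_image (f := fun q => q.1) _ D fun e he => ?_).trans
      (Nat.mul_le_mul_left _ ((Finset.card_le_card fun e he => ?_).trans hE))
    · refine (Finset.card_le_card_of_injOn (fun q => q.2.2) (fun q hq => ?_)
        fun q hq q' hq' h => ?_).trans (hkey (key e.2))
      · obtain ⟨hqk, rfl⟩ := Finset.mem_filter.mp hq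
        obtain ⟨hqQ, hk⟩ := Finset.mem_filter.mp hqk
        exact Finset.mem_filter.mpr ⟨Finset.mem_image_of_mem _
          (Finset.mem_product.mp (Finset.mem_filter.mp hqQ).1).2, hk.symm⟩
      · obtain ⟨hq, hqe⟩ := Finset.mem_filter.mp hq
        obtain ⟨hq', hqe'⟩ := Finset.mem_filter.mp hq'
        have e1 := (Finset.mem_filter.mp (Finset.mem_filter.mp hq).1).2
        have e2 := (Finset.mem_filter.mp (Finset.mem_filter.mp hq').1).2
        refine Prod.ext (hqe.trans hqe'.symm) (Prod.ext ?_ h)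
        rw [← e1, ← e2, hqe, hqe']
    · obtain ⟨q, hq, rfl⟩ := Finset.mem_image.mp he
      exact (Finset.mem_product.mp (Finset.mem_filter.mp (Finset.mem_filter.mp hq).1).1).1
  have h4 : (Q.filter fun q => ¬ key q.1.2 = key q.2.2).card ≤ D * (n * n) := by
    refine (Finset.card_le_mul_card_image_of_maps_to (f := fun q => (q.1.2, q.2.2)) (t := R ×ˢ R)
      (fun q hq => ?_) D fun r _ => ?_).trans ?_
    · have hq := Finset.mem_product.mp (Finset.mem_filter.mp (Finset.mem_filter.mp hq).1).1
      exact Finset.mem_product.mpr ⟨Finset.mem_image_of_mem _ hq.1, Finset.mem_image_of_mem _ hq.2⟩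
    · by_cases hr : key r.1 = key r.2
      · rw [Finset.card_eq_zero.mpr]
        · exact Nat.zero_le _
        · refine Finset.eq_empty_of_forall_notMem fun q hq => ?_
          obtain ⟨hqk, rfl⟩ := Finset.mem_filter.mp hq
          exact (Finset.mem_filter.mp hqk).2 hr
      · refine (Finset.card_le_card_of_injOn (fun q => q.1.1) (fun q hq => ?_)
          fun q hq q' hq' h => ?_).trans (hcodeg r.1 r.2 hr)
        · obtain ⟨hqk, rfl⟩ := Finset.mem_filter.mp hq
          obtain ⟨hqE, h'⟩ := Finset.mem_filter.mp (Finset.mem_filter.mp hqk).1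
          obtain ⟨e1, e2⟩ := Finset.mem_product.mp hqE
          refine Finset.mem_filter.mpr ⟨Finset.mem_image_of_mem _ e1, e1, ?_⟩
          beta_reduce
          rw [h']
          exact e2
        · obtain ⟨hq, hqe⟩ := Finset.mem_filter.mp hq
          obtain ⟨hq', hqe'⟩ := Finset.mem_filter.mp hq'
          have e1 := (Finset.mem_filter.mp (Finset.mem_filter.mp hq).1).2
          have e2 := (Finset.mem_filter.mp (Finset.mem_filter.mp hq').1).2
          rw [← hqe'] at hqe
          obtain ⟨e3, e4⟩ := Prod.mk.inj hqe
          refine Prod.ext (Prod.ext h e3) (Prod.ext ?_ e4)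
          rw [← e1, ← e2]
          exact h
    · rw [Finset.card_product]
      exact Nat.mul_le_mul_left _ (Nat.mul_le_mul hR hR)
  have h5 : Q.card ≤ 2 * D * n ^ 2 := by
    rw [← Finset.card_filter_add_card_filter_not (fun q => key q.1.2 = key q.2.2)]
    refine (add_le_add h3 h4).trans (le_of_eq ?_)
    ring
  calc E.card ^ 2 ≤ L.card * ∑ l ∈ L, (d l).card ^ 2 := by
        rw [h1]
        exact sq_sum_le_card_mul_sum_sq
    _ ≤ n * (2 * D * n ^ 2) := by
        rw [h2]
        exact Nat.mul_le_mul hL h5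

section CurveFamilies

open Function Polynomial

variable {σ : Type*} [DecidableEq σ]

/-- In every coordinate direction, `G x y` is given by a plane curve of type `D`. -/
def IsCurveFamily (D : ℕ) (G : (σ → ℤ) → ℚ → ℚ) : Prop :=
  ∀ (z : σ → ℤ) (i : σ) (c₁ c₂ : ℤ), ∃ g : ℚ[X][X], IsPlaneCurve D g ∧
    ∀ (t : ℤ) (y : ℚ), G (update z i (c₁ + t)) (c₂ + y) = g.evalEval (t : ℚ) y

/-- The hypersurface `G = 0` contains the graph of `F` over the coordinate plane in the directions
`T` through `z`. -/
structure IsComponent (G : (σ → ℤ) → ℚ → ℚ) (z : σ → ℤ) (T : Finset σ) (F : (σ → ℤ) → ℚ) :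
    Prop where
  multiAffine : IsMultiAffine T F
  eq_zero : ∀ x, G (T.piecewise x z) (F x) = 0

/-- An integer point of `G = 0` in a box that lies on no component. -/
structure IsSporadic [Fintype σ] (G : (σ → ℤ) → ℚ → ℚ) (z : σ → ℤ) (T : Finset σ) (c : σ → ℤ)
    (d : ℤ) (B : ℕ) (P : (σ → ℤ) × ℤ) : Prop where
  mem_coordBox : P.1 ∈ coordBox z c T B
  mem_Icc : d ≤ P.2 ∧ P.2 ≤ d + B
  eq_zero : G P.1 P.2 = 0
  ne_component : ∀ F, IsComponent G z T F → F P.1 ≠ P.2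

variable {D : ℕ} {G : (σ → ℤ) → ℚ → ℚ} {z c : σ → ℤ} {T : Finset σ} {d : ℤ} {B : ℕ}

theorem card_components_le [Fintype σ] (hG : IsCurveFamily D G) (i : σ)
    (A : Finset ((σ → ℤ) → ℚ)) (hA : ∀ F ∈ A, IsComponent G z T F) : A.card ≤ D := by
  classical
  obtain ⟨x, hx⟩ := IsMultiAffine.exists_ne_zero (T := T)
    (A.offDiag.image fun p x => p.1 x - p.2 x)
    (fun F hF => by
      obtain ⟨p, hp, rfl⟩ := Finset.mem_image.mp hF
      obtain ⟨h1, h2, -⟩ := Finset.mem_offDiag.mp hp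
      exact (hA _ h1).multiAffine.sub (hA _ h2).multiAffine)
    (fun F hF => by
      obtain ⟨p, hp, rfl⟩ := Finset.mem_image.mp hF
      obtain ⟨-, -, h3⟩ := Finset.mem_offDiag.mp hp
      obtain ⟨x, hx⟩ := Function.ne_iff.mp h3
      exact ⟨x, sub_ne_zero.mpr hx⟩)
  have hinj : Set.InjOn (fun F : (σ → ℤ) → ℚ => F x) A := fun F hF F' hF' h => by
    by_contra hne
    exact hx (fun x => F x - F' x) (Finset.mem_image.mpr
      ⟨(F, F'), Finset.mem_offDiag.mpr ⟨hF, hF', hne⟩, rfl⟩) (sub_eq_zero.mpr h)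
  obtain ⟨g, hg, hgG⟩ := hG (T.piecewise x z) i (T.piecewise x z i) 0
  rw [← Finset.card_image_of_injOn hinj]
  refine card_le_of_eval_eq_zero (hg.map_evalRingHom_ne_zero 0)
    (natDegree_map_le.trans hg.natDegree_le) _ fun y hy => ?_
  obtain ⟨F, hF, rfl⟩ := Finset.mem_image.mp hy
  have h1 := hgG 0 (F x)
  rw [add_zero, update_eq_self, Int.cast_zero, zero_add, (hA F hF).eq_zero] at h1
  rw [map_evalRingHom_eval, ← h1]

/-- A multi-affine function that lies on `G = 0` for many values of one coordinate is a
component. -/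
theorem IsCurveFamily.isComponent (hG : IsCurveFamily D G) {F : (σ → ℤ) → ℚ}
    (hF : IsMultiAffine T F) {i : σ} (hi : i ∈ T) {A : Finset ℤ} (hA : D < A.card)
    (h : ∀ t ∈ A, ∀ x, G (T.piecewise (update x i t) z) (F (update x i t)) = 0) :
    IsComponent G z T F where
  multiAffine := hF
  eq_zero x := by
    obtain ⟨α, β, hαβ⟩ := hF.affine i x
    obtain ⟨g, hg, hgG⟩ := hG (T.piecewise x z) i 0 0
    have hpw (t : ℤ) : T.piecewise (update x i t) z = update (T.piecewise x z) i t := by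
      rw [Finset.update_piecewise_of_mem _ _ _ hi]
    have hev (t : ℤ) : (g.eval (C α + C β * X)).eval (t : ℚ) =
        G (T.piecewise (update x i t) z) (F (update x i t)) := by
      have h1 := hgG t (α + β * t)
      rw [zero_add, Int.cast_zero, zero_add] at h1
      rw [hpw, hαβ, h1, eval_eval_eq_evalEval]
      simp
    have hzero : g.eval (C α + C β * X) = 0 := by
      by_contra hne
      have h1 := card_le_of_eval_eq_zero hne (hg.natDegree_eval_le (by
        rw [add_comm]; exact natDegree_linear_le)) (A.image fun t : ℤ => (t : ℚ))
        fun y hy => by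
          obtain ⟨t, ht, rfl⟩ := Finset.mem_image.mp hy
          rw [hev, h t ht x]
      rw [Finset.card_image_of_injective _ Int.cast_injective] at h1
      omega
    have h2 := hev (x i)
    rw [hzero, eval_zero, update_eq_self] at h2
    exact h2.symm

section slices

variable [Fintype σ]

theorem card_slices_le (hG : IsCurveFamily D G) {i : σ} (hi : i ∈ T)
    (S : Finset ((σ → ℤ) × ℤ)) (hS : ∀ P ∈ S, IsSporadic G z T c d B P)
    (L : (σ → ℤ) × ℤ → (σ → ℤ) → ℚ)
    (hL : ∀ P ∈ S, IsComponent G (update z i (P.1 i)) (T.erase i) (L P))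
    [DecidableEq (ℤ × ((σ → ℤ) → ℚ))] :
    (S.image fun P => (P.1 i, L P)).card ≤ D * (B + 1) := by
  classical
  have hB : (Finset.Icc (c i) (c i + B)).card = B + 1 := by
    rw [Int.card_Icc]
    omega
  rw [← hB]
  refine Finset.card_le_mul_card_image_of_maps_to (f := Prod.fst) (fun l hl => ?_) D fun t _ => ?_
  · obtain ⟨P, hP, rfl⟩ := Finset.mem_image.mp hl
    exact Finset.mem_Icc.mpr ((_root_.mem_coordBox.mp (hS P hP).mem_coordBox).1 i hi)
  · rw [← Finset.card_image_of_injOn (f := Prod.snd)]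
    · refine card_components_le (z := update z i t) (T := T.erase i) hG i _ fun F hF => ?_
      obtain ⟨l, hl, rfl⟩ := Finset.mem_image.mp hF
      obtain ⟨hlS, rfl⟩ := Finset.mem_filter.mp hl
      obtain ⟨P, hP, rfl⟩ := Finset.mem_image.mp hlS
      exact hL P hP
    · intro l hl l' hl' h
      exact Prod.ext ((Finset.mem_filter.mp hl).2.trans (Finset.mem_filter.mp hl').2.symm) h

theorem card_sporadic_le_of_disagree (hG : IsCurveFamily D G) {i k : σ} (hi : i ∈ T) (hk : k ∈ T)
    {m : ℕ} (hm : ((T.erase i).erase k).card = m)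
    (S : Finset ((σ → ℤ) × ℤ)) (hS : ∀ P ∈ S, IsSporadic G z T c d B P)
    (L L' : (σ → ℤ) × ℤ → (σ → ℤ) → ℚ)
    (hL : ∀ P ∈ S, IsComponent G (update z i (P.1 i)) (T.erase i) (L P))
    (hLP : ∀ P ∈ S, L P P.1 = P.2)
    (hL' : ∀ P ∈ S, IsComponent G (update z k (P.1 k)) (T.erase k) (L' P))
    (hLP' : ∀ P ∈ S, L' P P.1 = P.2)
    (hne : ∀ P ∈ S, ∃ x, L P (update x k (P.1 k)) ≠ L' P (update x i (P.1 i))) :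
    S.card ≤ D ^ 2 * m * (B + 1) ^ (m + 1) := by
  classical
  refine (Finset.card_le_mul_card_image_of_maps_to
    (f := fun P => ((P.1 i, L P), (P.1 k, L' P)))
    (t := (S.image fun P => (P.1 i, L P)) ×ˢ (S.image fun P => (P.1 k, L' P)))
    (fun P hP => Finset.mem_product.mpr
      ⟨Finset.mem_image_of_mem (fun P : (σ → ℤ) × ℤ => (P.1 i, L P)) hP,
        Finset.mem_image_of_mem (fun P : (σ → ℤ) × ℤ => (P.1 k, L' P)) hP⟩)
    (m * (B + 1) ^ (m - 1)) fun e _ => ?_).trans ?_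
  · rcases Finset.eq_empty_or_nonempty
      (S.filter fun P => ((P.1 i, L P), (P.1 k, L' P)) = e) with h0 | ⟨P₀, hP₀⟩
    · rw [h0]
      exact Nat.zero_le _
    obtain ⟨hP₀S, rfl⟩ := Finset.mem_filter.mp hP₀
    have hF := ((hL P₀ hP₀S).multiAffine.restrict k (P₀.1 k)).sub
      (Finset.erase_right_comm (s := T) ▸ (hL' P₀ hP₀S).multiAffine.restrict i (P₀.1 i))
    obtain ⟨x₀, hx₀⟩ := hne P₀ hP₀S
    have h1 := hF.card_zeros_le ⟨x₀, sub_ne_zero.mpr hx₀⟩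
      (update (update z i (P₀.1 i)) k (P₀.1 k)) c B
    rw [hm] at h1
    refine le_trans ?_ h1
    refine Finset.card_le_card_of_injOn Prod.fst (fun P hP => ?_) fun P hP Q hQ h => ?_
    · obtain ⟨hPS, hPe⟩ := Finset.mem_filter.mp hP
      simp only [Prod.mk.injEq] at hPe
      obtain ⟨⟨e1, e2⟩, e3, e4⟩ := hPe
      refine Finset.mem_filter.mpr ⟨?_, ?_⟩
      · rw [← e1, ← e3]
        exact mem_coordBox_update (mem_coordBox_update (hS P hPS).mem_coordBox i) k
      · rw [← e1, ← e2, ← e3, ← e4, update_eq_self, update_eq_self, hLP P hPS, hLP' P hPS, sub_self]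
    · obtain ⟨hPS, hPe⟩ := Finset.mem_filter.mp hP
      obtain ⟨hQS, hQe⟩ := Finset.mem_filter.mp hQ
      simp only [Prod.mk.injEq] at hPe hQe
      refine Prod.ext h ?_
      have h2 : (P.2 : ℚ) = Q.2 := by rw [← hLP P hPS, ← hLP Q hQS, hPe.1.2, hQe.1.2, h]
      exact_mod_cast h2
  · rw [Finset.card_product]
    refine (Nat.mul_le_mul_left _ (Nat.mul_le_mul (card_slices_le hG hi S hS L hL)
      (card_slices_le hG hk S hS L' hL'))).trans ?_
    rcases Nat.eq_zero_or_pos m with rfl | hpos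
    · simp
    · obtain ⟨m, rfl⟩ := Nat.exists_eq_succ_of_ne_zero hpos.ne'
      rw [Nat.succ_sub_one]
      apply le_of_eq
      rw [Nat.succ_eq_add_one]
      ring

theorem card_sporadic_le_of_agree (hG : IsCurveFamily D G) {i k : σ} (hi : i ∈ T) (hk : k ∈ T)
    (hik : i ≠ k) {m : ℕ} (hm : ((T.erase i).erase k).card = m)
    (S : Finset ((σ → ℤ) × ℤ)) (hS : ∀ P ∈ S, IsSporadic G z T c d B P)
    (L L' : (σ → ℤ) × ℤ → (σ → ℤ) → ℚ)
    (hL : ∀ P ∈ S, IsComponent G (update z i (P.1 i)) (T.erase i) (L P))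
    (hLP : ∀ P ∈ S, L P P.1 = P.2)
    (hL' : ∀ P ∈ S, IsComponent G (update z k (P.1 k)) (T.erase k) (L' P))
    (hLP' : ∀ P ∈ S, L' P P.1 = P.2)
    (heq : ∀ P ∈ S, ∀ x, L P (update x k (P.1 k)) = L' P (update x i (P.1 i))) :
    ∃ e : ℕ, S.card ≤ (B + 1) ^ m * e ∧ e ^ 2 ≤ 2 * D ^ 4 * (B + 1) ^ 3 := by
  classical
  set E := S.image fun P => ((P.1 i, L P), (P.1 k, L' P))
  have hE1 : E.image Prod.fst = S.image fun P => (P.1 i, L P) := Finset.image_image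
  have hE2 : E.image Prod.snd = S.image fun P => (P.1 k, L' P) := Finset.image_image
  have hagree {t s : ℤ} {ℓ ℓ' : (σ → ℤ) → ℚ} (he : ((t, ℓ), (s, ℓ')) ∈ E) (x : σ → ℤ) :
      ℓ (update x k s) = ℓ' (update x i t) := by
    obtain ⟨P, hP, h⟩ := Finset.mem_image.mp he
    simp only [Prod.mk.injEq] at h
    obtain ⟨⟨rfl, rfl⟩, rfl, rfl⟩ := h
    exact heq P hP x
  have hleft {t s : ℤ} {ℓ ℓ' : (σ → ℤ) → ℚ} (he : ((t, ℓ), (s, ℓ')) ∈ E) :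
      IsComponent G (update z i t) (T.erase i) ℓ := by
    obtain ⟨P, hP, h⟩ := Finset.mem_image.mp he
    simp only [Prod.mk.injEq] at h
    obtain ⟨⟨rfl, rfl⟩, rfl, rfl⟩ := h
    exact hL P hP
  have hright {t s : ℤ} {ℓ ℓ' : (σ → ℤ) → ℚ} (he : ((t, ℓ), (s, ℓ')) ∈ E) :
      IsMultiAffine (T.erase k) ℓ' := by
    obtain ⟨P, hP, h⟩ := Finset.mem_image.mp he
    simp only [Prod.mk.injEq] at h
    obtain ⟨⟨rfl, rfl⟩, rfl, rfl⟩ := h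
    exact (hL' P hP).multiAffine
  refine ⟨E.card, ?_, ?_⟩
  · refine Finset.card_le_mul_card_image S _ fun e he => ?_
    obtain ⟨P₀, -, rfl⟩ := Finset.mem_image.mp he
    rw [← hm, ← card_coordBox (z := update (update z i (P₀.1 i)) k (P₀.1 k)) (c := c)]
    refine Finset.card_le_card_of_injOn Prod.fst (fun P hP => ?_) fun P hP Q hQ h => ?_
    · obtain ⟨hPS, hPe⟩ := Finset.mem_filter.mp hP
      simp only [Prod.mk.injEq] at hPe
      obtain ⟨⟨e1, e2⟩, e3, e4⟩ := hPe
      rw [← e1, ← e3]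
      exact mem_coordBox_update (mem_coordBox_update (hS P hPS).mem_coordBox i) k
    · obtain ⟨hPS, hPe⟩ := Finset.mem_filter.mp hP
      obtain ⟨hQS, hQe⟩ := Finset.mem_filter.mp hQ
      simp only [Prod.mk.injEq] at hPe hQe
      refine Prod.ext h ?_
      have h2 : (P.2 : ℚ) = Q.2 := by rw [← hLP P hPS, ← hLP Q hQS, hPe.1.2, hQe.1.2, h]
      exact_mod_cast h2
  · refine (card_edges_sq_le E (n := D * (B + 1)) (D := D) ?_ ?_ Prod.fst (fun s => ?_) ?_).trans
      (le_of_eq (by ring))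
    · rw [hE1]
      exact card_slices_le hG hi S hS L hL
    · rw [hE2]
      exact card_slices_le hG hk S hS L' hL'
    · rw [← Finset.card_image_of_injOn (f := Prod.snd)]
      · refine card_components_le (z := update z k s) (T := T.erase k) hG k _ fun F hF => ?_
        obtain ⟨l, hl, rfl⟩ := Finset.mem_image.mp hF
        obtain ⟨hlE, rfl⟩ := Finset.mem_filter.mp hl
        rw [hE2] at hlE
        obtain ⟨P, hP, rfl⟩ := Finset.mem_image.mp hlE
        exact hL' P hP
      · intro l hl l' hl' h
        exact Prod.ext ((Finset.mem_filter.mp hl).2.trans (Finset.mem_filter.mp hl').2.symm) h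
    · rintro ⟨s₀, ℓ₀⟩ ⟨s₁, ℓ₁⟩ (hs : s₀ ≠ s₁)
      set A := (E.image Prod.fst).filter fun l => (l, (s₀, ℓ₀)) ∈ E ∧ (l, (s₁, ℓ₁)) ∈ E
      have hA {t : ℤ} {ℓ : (σ → ℤ) → ℚ} (hl : (t, ℓ) ∈ A) (x : σ → ℤ) :
          ℓ x = ℓ₀ (update x i t) +
            (x k - s₀) / (s₁ - s₀) * (ℓ₁ (update x i t) - ℓ₀ (update x i t)) := by
        obtain ⟨-, h1, h2⟩ := Finset.mem_filter.mp hl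
        rw [← hagree h1, ← hagree h2]
        exact (hleft h1).multiAffine.eq_interpolation k hs x
      have hinj : Set.InjOn Prod.fst (A : Set (ℤ × ((σ → ℤ) → ℚ))) := by
        rintro ⟨t, ℓ⟩ hl ⟨t', ℓ'⟩ hl' (rfl : t = t')
        refine Prod.ext rfl (funext fun x => ?_)
        dsimp only
        rw [hA hl, hA hl']
      by_contra! hcon
      rw [← Finset.card_image_of_injOn hinj] at hcon
      have hAne : A.Nonempty := by
        rw [← Finset.image_nonempty (f := Prod.fst), ← Finset.card_pos]
        omega
      obtain ⟨⟨t₀, ℓ⟩, hl⟩ := hAne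
      obtain ⟨-, h1, h2⟩ := Finset.mem_filter.mp hl
      have hcomp := hG.isComponent (z := z)
        ((hright h1).interpolation hk (hright h2) s₀ s₁) hi hcon fun t ht x => by
          obtain ⟨⟨t, ℓ⟩, hl, rfl⟩ := Finset.mem_image.mp ht
          have h3 := hA hl x
          have h4 := (hleft (Finset.mem_filter.mp hl).2.1).eq_zero x
          have h5 : T.piecewise (update x i t) z = (T.erase i).piecewise x (update z i t) := by
            funext j
            by_cases hji : j = i
            · subst hji
              simp [hi]
            · simp [Finset.piecewise, hji]
          dsimp only
          rw [h5, update_of_ne hik.symm, ← h3, h4]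
      obtain ⟨P, hP, h⟩ := Finset.mem_image.mp h1
      simp only [Prod.mk.injEq] at h
      obtain ⟨-, rfl, rfl⟩ := h
      refine (hS P hP).ne_component _ hcomp ?_
      rw [sub_self, zero_div, zero_mul, add_zero, hLP' P hP]

end slices

end CurveFamilies

section SporadicBound

open Function Polynomial

/-- A uniform bound `C * B ^ (m - 1 / 2 + ε)` for the number of sporadic points in boxes of
dimension `m`. -/
def SporadicBound (σ : Type*) [DecidableEq σ] [Fintype σ] (D : ℕ) (ε : ℝ) (m : ℕ) (C : ℝ) : Prop :=
  ∀ (G : (σ → ℤ) → ℚ → ℚ) (z c : σ → ℤ) (T : Finset σ) (d : ℤ) (B : ℕ), IsCurveFamily D G →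
    T.card = m → 1 ≤ B → ∀ S : Finset ((σ → ℤ) × ℤ), (∀ P ∈ S, IsSporadic G z T c d B P) →
    (S.card : ℝ) ≤ C * (B : ℝ) ^ ((m : ℝ) - 1 / 2 + ε)

variable {σ : Type*} [DecidableEq σ] [Fintype σ]

theorem card_le_card_filter_add_of_lines {N D : ℕ} (S : Finset (ℤ × ℤ)) {Λ : Finset ℚ[X]}
    (hΛ : Λ.card ≤ N) (hline : ∀ r ∈ Λ, (S.filter fun P => r.eval (P.1 : ℚ) = P.2).card ≤ D) :
    S.card ≤ (S.filter fun P => ∀ r ∈ Λ, r.eval (P.1 : ℚ) ≠ P.2).card + N * D := by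
  classical
  have hsub : S ⊆ (S.filter fun P => ∀ r ∈ Λ, r.eval (P.1 : ℚ) ≠ P.2) ∪
      Λ.biUnion fun r => S.filter fun P => r.eval (P.1 : ℚ) = P.2 := by
    intro P hP
    simp only [Finset.mem_union, Finset.mem_filter, Finset.mem_biUnion]
    by_contra! h
    exact (h.1 hP).elim fun r hr => h.2 r hr.1 hP hr.2
  exact (Finset.card_le_card hsub).trans ((Finset.card_union_le _ _).trans (Nat.add_le_add_left
    ((Finset.card_biUnion_le_card_mul _ _ _ hline).trans (Nat.mul_le_mul_right _ hΛ)) _))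

theorem exists_sporadicBound_one (D : ℕ) {ε : ℝ} (hε : 0 < ε) :
    ∃ C, 0 ≤ C ∧ SporadicBound σ D ε 1 C := by
  obtain ⟨N, K, hK, hcov⟩ := exists_linear_cover D hε
  refine ⟨K + N * D, by positivity, fun G z c T d B hG hT hB S hS => ?_⟩
  obtain ⟨i, rfl⟩ := Finset.card_eq_one.mp hT
  obtain ⟨g, hg, hgG⟩ := hG z i (c i) d
  have hz {P : (σ → ℤ) × ℤ} (hP : P ∈ S) (t : ℤ) : update z i t = update P.1 i t := by
    funext l
    by_cases hl : l = i
    · rw [hl, update_self, update_self]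
    · rw [update_of_ne hl, update_of_ne hl,
        (mem_coordBox.mp (hS P hP).mem_coordBox).2 l (by simpa using hl)]
  have hgP {P : (σ → ℤ) × ℤ} (hP : P ∈ S) :
      g.evalEval ((P.1 i - c i : ℤ) : ℚ) ((P.2 - d : ℤ) : ℚ) = 0 := by
    rw [← hgG, hz hP]
    have := (hS P hP).eq_zero
    simpa using this
  have hcoord {P Q : (σ → ℤ) × ℤ} (hP : P ∈ S) (hQ : Q ∈ S) (h : P.1 i = Q.1 i) :
      P.1 = Q.1 := by
    rw [← update_eq_self i P.1, ← update_eq_self i Q.1, ← hz hP, ← hz hQ, h]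
  let f (P : (σ → ℤ) × ℤ) : ℤ × ℤ := (P.1 i - c i, P.2 - d)
  have hf : Set.InjOn f S := fun P hP Q hQ h => by
    simp only [f, Prod.mk.injEq, sub_left_inj] at h
    exact Prod.ext (hcoord hP hQ h.1) h.2
  obtain ⟨Λ, hΛ, hΛdeg, hΛS⟩ := hcov B hB (S.image f) (fun P hP => by
    obtain ⟨Q, hQ, rfl⟩ := Finset.mem_image.mp hP
    have h1 := (mem_coordBox.mp (hS Q hQ).mem_coordBox).1 i (Finset.mem_singleton_self i)
    have h2 := (hS Q hQ).mem_Icc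
    dsimp only [f]
    omega) g hg (fun P hP => by
    obtain ⟨Q, hQ, rfl⟩ := Finset.mem_image.mp hP
    exact hgP hQ)
  have hline : ∀ r ∈ Λ, ((S.image f).filter fun P => r.eval (P.1 : ℚ) = P.2).card ≤ D := by
    intro r hr
    by_cases h0 : g.eval r = 0
    · rw [Finset.filter_false_of_mem]
      · exact Nat.zero_le _
      · intro P hP hPr
        obtain ⟨Q, hQ, rfl⟩ := Finset.mem_image.mp hP
        obtain ⟨a, b, hab⟩ : ∃ a b : ℚ, r = C a * X + C b := exists_eq_X_add_C_of_natDegree_le_one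
          (hΛdeg r hr)
        refine (hS Q hQ).ne_component (fun x => d + r.eval ((x i - c i : ℤ) : ℚ))
          ⟨⟨fun j hj x t => ?_, fun j x => ?_⟩, fun x => ?_⟩ ?_
        · rw [update_of_ne]
          rintro rfl
          exact hj (Finset.mem_singleton_self _)
        · by_cases hj : j = i
          · subst hj
            refine ⟨d + (a * (-c j) + b), a, fun t => ?_⟩
            rw [hab, update_self]
            simp
            ring
          · refine ⟨d + r.eval ((x i - c i : ℤ) : ℚ), 0, fun t => ?_⟩
            rw [update_of_ne (Ne.symm hj)]
            ring
        · have h1 : ({i} : Finset σ).piecewise x z = update z i (c i + (x i - c i)) := by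
            rw [Finset.piecewise_singleton, add_sub_cancel]
          rw [h1, hgG, ← eval_eval_eq_evalEval, h0, eval_zero]
        · dsimp only [f] at hPr
          rw [hPr]
          push_cast
          ring
    · rw [← Finset.card_image_of_injOn (f := fun P : ℤ × ℤ => (P.1 : ℚ))]
      · refine card_le_of_eval_eq_zero h0 (hg.natDegree_eval_le (hΛdeg r hr)) _ fun x hx => ?_
        obtain ⟨P, hP, rfl⟩ := Finset.mem_image.mp hx
        obtain ⟨hPS, hPr⟩ := Finset.mem_filter.mp hP
        obtain ⟨Q, hQ, rfl⟩ := Finset.mem_image.mp hPS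
        rw [eval_eval_eq_evalEval, hPr]
        exact hgP hQ
      · intro P hP Q hQ h
        have hPr := (Finset.mem_filter.mp hP).2
        have hQr := (Finset.mem_filter.mp hQ).2
        dsimp only at h
        rw [h, hQr] at hPr
        exact Prod.ext (by exact_mod_cast h) (by exact_mod_cast hPr.symm)
  have hB' : (1 : ℝ) ≤ B := by exact_mod_cast hB
  have hone : 1 ≤ (B : ℝ) ^ (1 / 2 + ε) := Real.one_le_rpow hB' (by linarith)
  have hsplit : S.card ≤ ((S.image f).filter fun P => ∀ r ∈ Λ, r.eval (P.1 : ℚ) ≠ P.2).card +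
      N * D := by
    have := card_le_card_filter_add_of_lines (S.image f) hΛ hline
    rwa [Finset.card_image_of_injOn hf] at this
  have hexp : ((1 : ℕ) : ℝ) - 1 / 2 + ε = 1 / 2 + ε := by norm_num
  rw [hexp]
  calc (S.card : ℝ) ≤ ((S.image f).filter fun P => ∀ r ∈ Λ, r.eval (P.1 : ℚ) ≠ P.2).card +
        N * D := by exact_mod_cast hsplit
    _ ≤ K * (B : ℝ) ^ (1 / 2 + ε) + N * D * (B : ℝ) ^ (1 / 2 + ε) :=
        add_le_add hΛS (le_mul_of_one_le_right (by positivity) hone)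
    _ = _ := by ring

open Classical in
/-- The sporadic points that are already sporadic on their slice in the direction `i`. -/
theorem SporadicBound.card_slice_sporadic_le {D m : ℕ} {ε C : ℝ} (h : SporadicBound σ D ε m C)
    {G : (σ → ℤ) → ℚ → ℚ} {z c : σ → ℤ} {T : Finset σ} {d : ℤ} {B : ℕ} (hG : IsCurveFamily D G)
    (hT : T.card = m + 1) (hB : 1 ≤ B) {i : σ} (hi : i ∈ T)
    (S : Finset ((σ → ℤ) × ℤ)) (hS : ∀ P ∈ S, IsSporadic G z T c d B P) :
    ((S.filter fun P => ∀ F, IsComponent G (update z i (P.1 i)) (T.erase i) F →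
      F P.1 ≠ P.2).card : ℝ) ≤ (B + 1) * (C * (B : ℝ) ^ ((m : ℝ) - 1 / 2 + ε)) := by
  set S' := S.filter fun P => ∀ F, IsComponent G (update z i (P.1 i)) (T.erase i) F → F P.1 ≠ P.2
  have h1 := Finset.card_eq_sum_card_fiberwise (s := S') (t := Finset.Icc (c i) (c i + B))
    (f := fun P => P.1 i) (fun P hP => Finset.mem_coe.mpr (Finset.mem_Icc.mpr
      ((mem_coordBox.mp (hS P (Finset.mem_filter.mp hP).1).mem_coordBox).1 i hi)))
  rw [h1]
  push_cast
  refine (Finset.sum_le_card_nsmul _ _ (C * (B : ℝ) ^ ((m : ℝ) - 1 / 2 + ε)) fun t _ => ?_).trans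
    (le_of_eq ?_)
  · refine h G (update z i t) c (T.erase i) d B hG ?_ hB _ fun P hP => ?_
    · rw [Finset.card_erase_of_mem hi, hT, Nat.add_sub_cancel]
    · obtain ⟨hPS', rfl⟩ := Finset.mem_filter.mp hP
      obtain ⟨hPS, hPc⟩ := Finset.mem_filter.mp hPS'
      exact ⟨mem_coordBox_update (hS P hPS).mem_coordBox i, (hS P hPS).mem_Icc,
        (hS P hPS).eq_zero, hPc⟩
  · have hcard : (Finset.Icc (c i) (c i + B)).card = B + 1 := by
      rw [Int.card_Icc]
      omega
    rw [hcard, nsmul_eq_mul]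
    push_cast
    rfl

theorem SporadicBound.succ {D m : ℕ} {ε C : ℝ} (hε : 0 < ε) (hC : 0 ≤ C)
    (h : SporadicBound σ D ε (m + 1) C) :
    SporadicBound σ D ε (m + 2) (4 * C + D ^ 2 * m * 2 ^ (m + 1) + 2 ^ m * (4 * D ^ 2)) := by
  classical
  intro G z c T d B hG hT hB S hS
  obtain ⟨i, hi⟩ : T.Nonempty := Finset.card_pos.mp (by omega)
  have hTi : (T.erase i).card = m + 1 := by rw [Finset.card_erase_of_mem hi, hT]; rfl
  obtain ⟨k, hk'⟩ : (T.erase i).Nonempty := Finset.card_pos.mp (by omega)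
  have hk : k ∈ T := Finset.mem_of_mem_erase hk'
  have hik : i ≠ k := (Finset.ne_of_mem_erase hk').symm
  have hTik : ((T.erase i).erase k).card = m := by rw [Finset.card_erase_of_mem hk', hTi]; rfl
  have hEi := h.card_slice_sporadic_le hG hT hB hi S hS
  have hEk := h.card_slice_sporadic_le hG hT hB hk S hS
  set Ei := S.filter fun P => ∀ F, IsComponent G (update z i (P.1 i)) (T.erase i) F → F P.1 ≠ P.2
  set Ek := S.filter fun P => ∀ F, IsComponent G (update z k (P.1 k)) (T.erase k) F → F P.1 ≠ P.2
  set S' := (S \ Ei) \ Ek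
  have hS'S : S' ⊆ S := Finset.sdiff_subset.trans Finset.sdiff_subset
  have hLi : ∀ P ∈ S', ∃ F, IsComponent G (update z i (P.1 i)) (T.erase i) F ∧ F P.1 = P.2 := by
    intro P hP
    by_contra! hcon
    exact (Finset.mem_sdiff.mp (Finset.mem_sdiff.mp hP).1).2
      (Finset.mem_filter.mpr ⟨hS'S hP, hcon⟩)
  have hLk : ∀ P ∈ S', ∃ F, IsComponent G (update z k (P.1 k)) (T.erase k) F ∧ F P.1 = P.2 := by
    intro P hP
    by_contra! hcon
    exact (Finset.mem_sdiff.mp hP).2 (Finset.mem_filter.mpr ⟨hS'S hP, hcon⟩)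
  choose! L hL using hLi
  choose! L' hL' using hLk
  set Sd := S'.filter fun P => ∃ x, L P (update x k (P.1 k)) ≠ L' P (update x i (P.1 i))
  set Sa := S'.filter fun P => ¬ ∃ x, L P (update x k (P.1 k)) ≠ L' P (update x i (P.1 i))
  have hSd : Sd ⊆ S' := Finset.filter_subset _ _
  have hSa : Sa ⊆ S' := Finset.filter_subset _ _
  have hd := card_sporadic_le_of_disagree hG hi hk hTik Sd (fun P hP => hS P (hS'S (hSd hP))) L L'
    (fun P hP => (hL P (hSd hP)).1) (fun P hP => (hL P (hSd hP)).2)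
    (fun P hP => (hL' P (hSd hP)).1) (fun P hP => (hL' P (hSd hP)).2)
    (fun P hP => (Finset.mem_filter.mp hP).2)
  obtain ⟨e, ha, he⟩ := card_sporadic_le_of_agree hG hi hk hik hTik Sa
    (fun P hP => hS P (hS'S (hSa hP))) L L'
    (fun P hP => (hL P (hSa hP)).1) (fun P hP => (hL P (hSa hP)).2)
    (fun P hP => (hL' P (hSa hP)).1) (fun P hP => (hL' P (hSa hP)).2)
    (fun P hP => by simpa using (Finset.mem_filter.mp hP).2)
  have hcard : S.card ≤ Ei.card + Ek.card + Sd.card + Sa.card := by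
    have h1 : Sd.card + Sa.card = S'.card := Finset.card_filter_add_card_filter_not _
    have h2 : (S \ Ei).card ≤ S'.card + Ek.card := Finset.card_le_card_sdiff_add_card
    have h3 := Finset.card_le_card_sdiff_add_card (s := S) (t := Ei)
    omega
  have hB' : (1 : ℝ) ≤ B := by exact_mod_cast hB
  have hB0 : (0 : ℝ) < B := by linarith
  have hB2 : (B : ℝ) + 1 ≤ 2 * B := by linarith
  set Y := (B : ℝ) ^ (((m + 2 : ℕ) : ℝ) - 1 / 2 + ε) with hY
  have hE : ((B : ℝ) + 1) * (C * (B : ℝ) ^ (((m + 1 : ℕ) : ℝ) - 1 / 2 + ε)) ≤ 2 * C * Y := by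
    have : Y = B * (B : ℝ) ^ (((m + 1 : ℕ) : ℝ) - 1 / 2 + ε) := by
      rw [hY, mul_comm, ← Real.rpow_add_one hB0.ne']
      congr 1
      push_cast
      ring
    rw [this]
    calc _ ≤ (2 * B) * (C * (B : ℝ) ^ (((m + 1 : ℕ) : ℝ) - 1 / 2 + ε)) := by gcongr
      _ = _ := by ring
  have hd' : (Sd.card : ℝ) ≤ D ^ 2 * m * 2 ^ (m + 1) * Y := by
    calc (Sd.card : ℝ) ≤ D ^ 2 * m * ((B : ℝ) + 1) ^ (m + 1) := by exact_mod_cast hd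
      _ ≤ D ^ 2 * m * (2 * B) ^ (m + 1) := by gcongr
      _ = D ^ 2 * m * 2 ^ (m + 1) * (B : ℝ) ^ (m + 1) := by rw [mul_pow]; ring
      _ ≤ D ^ 2 * m * 2 ^ (m + 1) * Y := by
        gcongr
        rw [hY, ← Real.rpow_natCast]
        refine Real.rpow_le_rpow_of_exponent_le hB' ?_
        push_cast
        linarith
  have he' : (e : ℝ) ≤ 4 * D ^ 2 * (B : ℝ) ^ (3 / 2 : ℝ) := by
    refine (pow_le_pow_iff_left₀ (by positivity) (by positivity) two_ne_zero).mp ?_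
    have h1 : ((B : ℝ) ^ (3 / 2 : ℝ)) ^ 2 = (B : ℝ) ^ 3 := by
      rw [← Real.rpow_natCast, ← Real.rpow_mul hB0.le, ← Real.rpow_natCast]
      norm_num
    calc (e : ℝ) ^ 2 ≤ 2 * (D : ℝ) ^ 4 * ((B : ℝ) + 1) ^ 3 := by exact_mod_cast he
      _ ≤ 2 * (D : ℝ) ^ 4 * (2 * B) ^ 3 := by gcongr
      _ = (4 * (D : ℝ) ^ 2) ^ 2 * (B : ℝ) ^ 3 := by ring
      _ = _ := by rw [mul_pow _ (_ ^ (3 / 2 : ℝ)), h1]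
  have ha' : (Sa.card : ℝ) ≤ 2 ^ m * (4 * D ^ 2) * Y := by
    calc (Sa.card : ℝ) ≤ ((B : ℝ) + 1) ^ m * e := by exact_mod_cast ha
      _ ≤ (2 * B) ^ m * (4 * D ^ 2 * (B : ℝ) ^ (3 / 2 : ℝ)) := by gcongr
      _ = 2 ^ m * (4 * D ^ 2) * ((B : ℝ) ^ (m : ℝ) * (B : ℝ) ^ (3 / 2 : ℝ)) := by
        rw [mul_pow, Real.rpow_natCast]
        ring
      _ ≤ _ := by
        gcongr
        rw [hY, ← Real.rpow_add hB0]
        refine Real.rpow_le_rpow_of_exponent_le hB' ?_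
        push_cast
        linarith
  have hcard' : (S.card : ℝ) ≤ Ei.card + Ek.card + Sd.card + Sa.card := by exact_mod_cast hcard
  calc (S.card : ℝ) ≤ 2 * C * Y + 2 * C * Y + D ^ 2 * m * 2 ^ (m + 1) * Y +
        2 ^ m * (4 * D ^ 2) * Y := by linarith
    _ = _ := by ring

theorem exists_sporadicBound (D : ℕ) {ε : ℝ} (hε : 0 < ε) (m : ℕ) :
    ∃ C, 0 ≤ C ∧ SporadicBound σ D ε m C := by
  rcases m with _ | m
  · refine ⟨0, le_rfl, fun G z c T d B _ hT _ S hS => ?_⟩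
    obtain rfl := Finset.card_eq_zero.mp hT
    rw [Finset.eq_empty_of_forall_notMem (s := S) fun P hP => ?_]
    · simp
    · have hz : P.1 = z := funext fun l =>
        (mem_coordBox.mp (hS P hP).mem_coordBox).2 l (Finset.notMem_empty l)
      refine (hS P hP).ne_component (fun _ => P.2)
        ⟨⟨fun _ _ _ _ => rfl, fun _ _ => ⟨P.2, 0, fun _ => by ring⟩⟩, fun x => ?_⟩ rfl
      rw [Finset.piecewise_empty, ← hz]
      exact (hS P hP).eq_zero
  induction m with
  | zero => exact exists_sporadicBound_one D hε
  | succ m ih =>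
    obtain ⟨C, hC, h⟩ := ih
    exact ⟨_, by positivity, h.succ hε hC⟩

end SporadicBound

section HomogeneousForms

open Function Polynomial

/-- A polynomial of total degree at most `d` in two variables whose coefficient at the `d`-th power
of the second variable is `c`. -/
structure HasTopCoeff {R : Type*} [CommRing R] (d : ℕ) (c : R) (g : R[X][X]) : Prop where
  natDegree_coeff_le : ∀ j, (g.coeff j).natDegree ≤ d - j
  natDegree_le : g.natDegree ≤ d
  coeff_eq : g.coeff d = C c

namespace HasTopCoeff

variable {R : Type*} [CommRing R] {d e : ℕ} {c c' : R} {g g' : R[X][X]}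

theorem isPlaneCurve (h : HasTopCoeff d c g) (hc : c ≠ 0) : IsPlaneCurve d g where
  natDegree_coeff_le := h.natDegree_coeff_le
  natDegree_le := h.natDegree_le
  coeff_ne_zero := by rwa [h.coeff_eq, Ne, C_eq_zero]

theorem zero (d : ℕ) : HasTopCoeff d (0 : R) 0 := ⟨by simp, by simp, by simp⟩

theorem add (h : HasTopCoeff d c g) (h' : HasTopCoeff d c' g') :
    HasTopCoeff d (c + c') (g + g') where
  natDegree_coeff_le j := by
    rw [coeff_add]
    exact natDegree_add_le_of_degree_le (h.natDegree_coeff_le j) (h'.natDegree_coeff_le j)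
  natDegree_le := natDegree_add_le_of_degree_le h.natDegree_le h'.natDegree_le
  coeff_eq := by rw [coeff_add, h.coeff_eq, h'.coeff_eq, C_add]

theorem mul (h : HasTopCoeff d c g) (h' : HasTopCoeff e c' g') :
    HasTopCoeff (d + e) (c * c') (g * g') where
  natDegree_coeff_le j := by
    rw [coeff_mul]
    refine natDegree_sum_le_of_forall_le _ _ fun p hp => ?_
    have hp_add := Finset.HasAntidiagonal.mem_antidiagonal.mp hp
    by_cases h1 : d < p.1
    · rw [coeff_eq_zero_of_natDegree_lt (h.natDegree_le.trans_lt h1), zero_mul, natDegree_zero]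
      exact Nat.zero_le _
    by_cases h2 : e < p.2
    · rw [coeff_eq_zero_of_natDegree_lt (h'.natDegree_le.trans_lt h2), mul_zero, natDegree_zero]
      exact Nat.zero_le _
    have := natDegree_mul_le_of_le (h.natDegree_coeff_le p.1) (h'.natDegree_coeff_le p.2)
    omega
  natDegree_le := natDegree_mul_le_of_le h.natDegree_le h'.natDegree_le
  coeff_eq := by
    rw [coeff_mul_add_eq_of_natDegree_le h.natDegree_le h'.natDegree_le, h.coeff_eq,
      h'.coeff_eq, C_mul]

theorem C_C (c : R) : HasTopCoeff 0 c (C (C c)) where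
  natDegree_coeff_le j := by
    rw [coeff_C]
    split_ifs <;> simp
  natDegree_le := (natDegree_C _).le
  coeff_eq := coeff_C_zero

theorem pow (h : HasTopCoeff d c g) (m : ℕ) : HasTopCoeff (m * d) (c ^ m) (g ^ m) := by
  induction m with
  | zero => simpa using C_C (1 : R)
  | succ m ih =>
    rw [pow_succ, pow_succ, Nat.succ_mul]
    exact ih.mul h

theorem sum {ι : Type*} (s : Finset ι) (c : ι → R) (g : ι → R[X][X])
    (h : ∀ i ∈ s, HasTopCoeff d (c i) (g i)) : HasTopCoeff d (∑ i ∈ s, c i) (∑ i ∈ s, g i) := by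
  classical
  induction s using Finset.induction_on with
  | empty => exact zero d
  | insert i s hi ih =>
    rw [Finset.sum_insert hi, Finset.sum_insert hi]
    exact (h i (Finset.mem_insert_self _ _)).add (ih fun j hj => h j (Finset.mem_insert_of_mem hj))

theorem prod {ι : Type*} (s : Finset ι) (d : ι → ℕ) (c : ι → R) (g : ι → R[X][X])
    (h : ∀ i ∈ s, HasTopCoeff (d i) (c i) (g i)) :
    HasTopCoeff (∑ i ∈ s, d i) (∏ i ∈ s, c i) (∏ i ∈ s, g i) := by
  classical
  induction s using Finset.induction_on with
  | empty => simpa using C_C (1 : R)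
  | insert i s hi ih =>
    rw [Finset.sum_insert hi, Finset.prod_insert hi, Finset.prod_insert hi]
    exact (h i (Finset.mem_insert_self _ _)).mul (ih fun j hj => h j (Finset.mem_insert_of_mem hj))

theorem linear (α β γ : R) : HasTopCoeff 1 γ (C (C γ) * X + C (C β * X + C α)) where
  natDegree_coeff_le j := by
    rw [coeff_add, coeff_C_mul, coeff_C, coeff_X]
    rcases j with _ | _ | j
    · simpa using natDegree_linear_le (a := β) (b := α)
    · simp
    · simp
  natDegree_le := natDegree_linear_le
  coeff_eq := by simp [coeff_C]

theorem eval₂ {σ S : Type*} [CommRing S] {f : MvPolynomial σ S} (hf : f.IsHomogeneous d)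
    (φ : S →+* R) (c : σ → R) (g : σ → R[X][X]) (h : ∀ l, HasTopCoeff 1 (c l) (g l)) :
    HasTopCoeff d (f.eval₂ φ c) (f.eval₂ ((C.comp C).comp φ) g) := by
  rw [MvPolynomial.eval₂_eq, MvPolynomial.eval₂_eq]
  refine sum _ _ _ fun m hm => ?_
  have h1 := (C_C (φ (f.coeff m))).mul
    (prod m.support (fun l => m l * 1) _ _ fun l _ => (h l).pow (m l))
  rwa [zero_add, Finset.sum_congr rfl fun l _ => mul_one (m l),
    ← hf.degree_eq_sum_deg_support hm] at h1

end HasTopCoeff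

/-- The value of `f` at the point `b + q (x + y u)`. -/
noncomputable def shiftedEval {σ : Type*} (f : MvPolynomial σ ℤ) (q : ℕ) (b u : σ → ℤ)
    (x : σ → ℤ) (y : ℚ) : ℚ :=
  f.eval₂ (Int.castRingHom ℚ) fun l => b l + q * (x l + y * u l)

theorem eval₂_mul_of_isHomogeneous {σ R S : Type*} [CommRing R] [CommRing S] {d : ℕ}
    {f : MvPolynomial σ R} (hf : f.IsHomogeneous d) (φ : R →+* S) (r : S) (g : σ → S) :
    f.eval₂ φ (fun l => r * g l) = r ^ d * f.eval₂ φ g := by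
  rw [MvPolynomial.eval₂_eq, MvPolynomial.eval₂_eq, Finset.mul_sum]
  refine Finset.sum_congr rfl fun m hm => ?_
  simp_rw [mul_pow]
  rw [Finset.prod_mul_distrib, Finset.prod_pow_eq_pow_sum, ← hf.degree_eq_sum_deg_support hm]
  ring

variable {σ : Type*} [DecidableEq σ] {D : ℕ} {f : MvPolynomial σ ℤ}

theorem isCurveFamily_shiftedEval (hf : f.IsHomogeneous D) {q : ℕ} (hq : 0 < q) (b : σ → ℤ)
    {u : σ → ℤ} (hu : MvPolynomial.eval u f ≠ 0) : IsCurveFamily D (shiftedEval f q b u) := by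
  intro z i c₁ c₂
  let α (l : σ) : ℚ := b l + q * ((update z i c₁ l : ℤ) + c₂ * u l)
  let β (l : σ) : ℚ := if l = i then q else 0
  refine ⟨_, (HasTopCoeff.eval₂ hf (Int.castRingHom ℚ) (fun l => (q : ℚ) * u l)
    (fun l => C (C ((q : ℚ) * u l)) * X + C (C (β l) * X + C (α l)))
    fun l => HasTopCoeff.linear _ _ _).isPlaneCurve ?_, fun t y => ?_⟩
  · rw [eval₂_mul_of_isHomogeneous hf]
    refine mul_ne_zero (pow_ne_zero _ (by exact_mod_cast hq.ne')) ?_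
    have : f.eval₂ (Int.castRingHom ℚ) (fun l => (u l : ℚ)) = (MvPolynomial.eval u f : ℤ) := by
      rw [← eq_intCast (Int.castRingHom ℚ), ← MvPolynomial.eval₂_id, MvPolynomial.eval₂_comp_left]
      rfl
    rw [this]
    exact_mod_cast hu
  · rw [← coe_evalEvalRingHom, MvPolynomial.eval₂_comp_left]
    refine congrArg₂ (fun φ g => MvPolynomial.eval₂ φ g f) (RingHom.ext_int _ _)
      (funext fun l => ?_)
    simp only [comp_apply, coe_evalEvalRingHom, evalEval, eval_add, eval_mul, eval_C, eval_X, α, β]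
    by_cases hl : l = i
    · subst hl
      simp
      ring
    · simp [hl]
      ring

end HomogeneousForms

section Components

open Function

variable {σ : Type*} [DecidableEq σ] [Fintype σ]

theorem IsMultiAffine.exists_mvPolynomial {T : Finset σ} {F : (σ → ℤ) → ℚ}
    (hF : IsMultiAffine T F) :
    ∃ Φ : MvPolynomial σ ℚ, ∀ x : σ → ℤ, F x = MvPolynomial.eval (fun l => (x l : ℚ)) Φ := by
  induction T using Finset.induction_on generalizing F with
  | empty =>
    refine ⟨MvPolynomial.C (F 0), fun x => ?_⟩
    rw [MvPolynomial.eval_C]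
    exact hF.congr_of_eqOn fun i hi => absurd hi (Finset.notMem_empty i)
  | insert k T hk ih =>
    have h (s : ℤ) : IsMultiAffine T fun x => F (update x k s) := by
      simpa [Finset.erase_insert hk] using hF.restrict k s
    obtain ⟨Φ₀, h₀⟩ := ih (h 0)
    obtain ⟨Φ₁, h₁⟩ := ih (h 1)
    refine ⟨Φ₀ + MvPolynomial.X k * (Φ₁ - Φ₀), fun x => ?_⟩
    rw [hF.eq_interpolation k zero_ne_one x, h₀, h₁]
    simp

variable {D : ℕ} {f : MvPolynomial σ ℤ}

theorem not_isComponent_shiftedEval (hf : f.IsHomogeneous D) (hD : 2 ≤ D)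
    (hirr : Irreducible (f.map (Int.castRingHom ℂ))) {q : ℕ} (hq : 0 < q) (a : σ → ℤ) {u : σ → ℤ}
    (hu : MvPolynomial.eval u f ≠ 0) {i : σ} (hi : u i ≠ 0) (F : (σ → ℤ) → ℚ) :
    ¬ IsComponent (shiftedEval f q (fun l => u i * a l) u) 0 (Finset.univ.erase i) F := by
  intro hF
  obtain ⟨Φ, hΦ⟩ := hF.multiAffine.exists_mvPolynomial
  have hq' : (q : ℂ) ≠ 0 := by exact_mod_cast hq.ne'
  have hi' : (u i : ℂ) ≠ 0 := by exact_mod_cast hi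
  let A := MvPolynomial σ ℂ
  let w (l : σ) : A := MvPolynomial.C (q : ℂ)⁻¹ * (MvPolynomial.X l - MvPolynomial.C (a l : ℂ))
  let x (l : σ) : A := MvPolynomial.C (u i : ℂ) * w l - MvPolynomial.C (u l : ℂ) * w i
  let Ψ : A := MvPolynomial.eval₂ (algebraMap ℚ A) x Φ
  let P : Polynomial A := f.eval₂ (Int.castRingHom _) fun l =>
    Polynomial.C (MvPolynomial.C ((u i * a l : ℤ) : ℂ) + MvPolynomial.C (q : ℂ) * x l) +
      Polynomial.C (MvPolynomial.C ((q : ℂ) * (u l : ℂ))) * Polynomial.X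
  have hPeval (r : A) : P.eval r = f.eval₂ (Int.castRingHom _) fun l =>
      MvPolynomial.C ((u i * a l : ℤ) : ℂ) + MvPolynomial.C (q : ℂ) * x l +
        MvPolynomial.C ((q : ℂ) * (u l : ℂ)) * r := by
    rw [← Polynomial.coe_evalRingHom, MvPolynomial.eval₂_comp_left]
    refine congrArg₂ (fun φ g => MvPolynomial.eval₂ φ g f) (RingHom.ext_int _ _)
      (funext fun l => ?_)
    simp
  have hqC : (MvPolynomial.C (q : ℂ) : A) * MvPolynomial.C (q : ℂ)⁻¹ = 1 := by
    rw [← MvPolynomial.C_mul, mul_inv_cancel₀ hq', MvPolynomial.C_1]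
  have hPw : P.eval (w i) = MvPolynomial.C ((u i : ℂ) ^ D) * f.map (Int.castRingHom ℂ) := by
    have hfmap : f.map (Int.castRingHom ℂ) = f.eval₂ (Int.castRingHom A) MvPolynomial.X := by
      rw [← MvPolynomial.eval₂_eta (f.map (Int.castRingHom ℂ)), MvPolynomial.eval₂_map]
      exact congrArg (fun φ => MvPolynomial.eval₂ φ _ f) (RingHom.ext_int _ _)
    rw [hPeval, hfmap, MvPolynomial.C_pow, ← eval₂_mul_of_isHomogeneous hf]
    refine congrArg (fun g => MvPolynomial.eval₂ _ g f) (funext fun l => ?_)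
    simp only [x, w, Int.cast_mul, MvPolynomial.C_mul]
    linear_combination (MvPolynomial.C (u i : ℂ) *
      (MvPolynomial.X l - MvPolynomial.C (a l : ℂ))) * hqC
  have hPΨ : P.eval Ψ = 0 := by
    refine MvPolynomial.funext_set (fun l => Set.range fun t : ℤ => (a l + q * t : ℂ))
      (fun l => Set.infinite_range_of_injective fun s t h => ?_) fun v hv => ?_
    · simpa [hq'] using h
    · choose t ht using fun l => hv l (Set.mem_univ l)
      let x₀ (l : σ) : ℤ := u i * t l - u l * t i
      have hw (l : σ) : MvPolynomial.eval v (w l) = t l := by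
        simp only [w, map_mul, map_sub, MvPolynomial.eval_C, MvPolynomial.eval_X, ← ht]
        field_simp
        ring
      have hx (l : σ) : MvPolynomial.eval v (x l) = (x₀ l : ℚ) := by
        simp [x, hw, x₀]
      have hΨ : MvPolynomial.eval v Ψ = (F x₀ : ℚ) := by
        rw [hΦ, ← eq_ratCast (Rat.castHom ℂ) (MvPolynomial.eval _ Φ),
          ← MvPolynomial.eval₂_id (g := fun l => (x₀ l : ℚ)),
          MvPolynomial.eval₂_comp_left (MvPolynomial.eval v),
          MvPolynomial.eval₂_comp_left (Rat.castHom ℂ)]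
        refine congrArg₂ (fun φ g => MvPolynomial.eval₂ φ g Φ) (Subsingleton.elim _ _)
          (funext fun l => ?_)
        simp [hx]
      have h0 := hF.eq_zero x₀
      have hx₀ : (Finset.univ.erase i).piecewise x₀ 0 = x₀ := by
        funext l
        by_cases hl : l = i
        · subst hl
          simp [x₀]
        · simp [hl]
      rw [hx₀, shiftedEval] at h0
      have h1 := congrArg (Rat.castHom ℂ) h0
      rw [MvPolynomial.eval₂_comp_left, map_zero] at h1
      rw [hPeval, MvPolynomial.eval₂_comp_left, map_zero, ← h1]
      refine congrArg₂ (fun φ g => MvPolynomial.eval₂ φ g f) (RingHom.ext_int _ _)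
        (funext fun l => ?_)
      simp [hx, hΨ]
      ring
  have hdvd : w i - Ψ ∣ f.map (Int.castRingHom ℂ) := by
    have h := Polynomial.sub_dvd_eval_sub (w i) Ψ P
    rw [hPΨ, sub_zero, hPw] at h
    exact (((isUnit_iff_ne_zero.mpr (pow_ne_zero D hi')).map MvPolynomial.C).dvd_mul_left).mp h
  obtain ⟨h, hh⟩ := hdvd
  let φ : A →+* Polynomial ℂ :=
    MvPolynomial.eval₂Hom Polynomial.C fun l => Polynomial.C (u l : ℂ) * Polynomial.X
  have hC (c : ℂ) : φ (MvPolynomial.C c) = Polynomial.C c := MvPolynomial.eval₂Hom_C _ _ _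
  have hX (l : σ) : φ (MvPolynomial.X l) = Polynomial.C (u l : ℂ) * Polynomial.X :=
    MvPolynomial.eval₂Hom_X' _ _ _
  have hφw (l : σ) : φ (w l) = Polynomial.C (q : ℂ)⁻¹ *
      (Polynomial.C (u l : ℂ) * Polynomial.X - Polynomial.C (a l : ℂ)) := by
    simp only [w, map_mul, map_sub, hC, hX]
  have hφΨ : ∃ κ, φ Ψ = Polynomial.C κ := by
    refine ⟨Φ.eval₂ (algebraMap ℚ ℂ) fun l => (q : ℂ)⁻¹ * (u l * a i - u i * a l), ?_⟩
    rw [MvPolynomial.eval₂_comp_left, MvPolynomial.eval₂_comp_left]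
    refine congrArg₂ (fun φ g => MvPolynomial.eval₂ φ g Φ) (Subsingleton.elim _ _)
      (funext fun l => ?_)
    simp only [comp_apply, x, map_sub, map_mul, hφw, hC]
    ring
  obtain ⟨κ, hκ⟩ := hφΨ
  have hdeg : (φ (w i - Ψ)).natDegree = 1 := by
    rw [map_sub, hκ, hφw, mul_sub, sub_sub, ← mul_assoc, ← Polynomial.C_mul, ← Polynomial.C_mul,
      ← Polynomial.C_add, sub_eq_add_neg, ← Polynomial.C_neg]
    exact Polynomial.natDegree_linear (mul_ne_zero (inv_ne_zero hq') hi')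
  have hφf : (φ (f.map (Int.castRingHom ℂ))).natDegree = D := by
    have : φ (f.map (Int.castRingHom ℂ)) =
        Polynomial.C ((MvPolynomial.eval u f : ℤ) : ℂ) * Polynomial.X ^ D := by
      have h1 : Polynomial.C ((MvPolynomial.eval u f : ℤ) : ℂ) =
          f.eval₂ (Int.castRingHom _) fun l => Polynomial.C (u l : ℂ) := by
        rw [← eq_intCast (Int.castRingHom ℂ), ← RingHom.comp_apply, ← MvPolynomial.eval₂_id,
          MvPolynomial.eval₂_comp_left]
        exact congrArg (fun φ => MvPolynomial.eval₂ φ _ f) (RingHom.ext_int _ _)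
      rw [h1, mul_comm, ← eval₂_mul_of_isHomogeneous hf, MvPolynomial.coe_eval₂Hom,
        MvPolynomial.eval₂_map]
      exact congrArg₂ (fun φ g => MvPolynomial.eval₂ φ g f) (RingHom.ext_int _ _)
        (funext fun l => mul_comm _ _)
    rw [this]
    exact Polynomial.natDegree_C_mul_X_pow _ _ (by exact_mod_cast hu)
  rcases hirr.isUnit_or_isUnit hh with h1 | h1
  · have := Polynomial.natDegree_eq_zero_of_isUnit (h1.map φ)
    omega
  · have h2 := Polynomial.natDegree_eq_zero_of_isUnit (h1.map φ)
    have h3 : φ (w i - Ψ) ≠ 0 := by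
      intro h0
      rw [h0] at hdeg
      simp at hdeg
    rw [hh, map_mul, Polynomial.natDegree_mul h3 (h1.map φ).ne_zero] at hφf
    omega

end Components

section Counting

variable {σ : Type*} {D : ℕ} {f : MvPolynomial σ ℤ}

theorem exists_eval_ne_zero_of_isHomogeneous [Finite σ] (hf : f.IsHomogeneous D) (h0 : f ≠ 0) :
    ∃ u : σ → ℤ, (∀ l, |(u l : ℝ)| ≤ D) ∧ MvPolynomial.eval u f ≠ 0 := by
  by_contra! h
  refine h0 (MvPolynomial.eq_zero_of_eval_zero_at_prod_finset f (fun _ => Finset.Icc 0 (D : ℤ))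
    (fun i => ?_) fun u hu => h u fun l => ?_)
  · have h1 := (MvPolynomial.degreeOf_le_totalDegree f i).trans hf.totalDegree_le
    rw [Int.card_Icc]
    omega
  · obtain ⟨h1, h2⟩ := Finset.mem_Icc.mp (hu l)
    rw [abs_of_nonneg (by exact_mod_cast h1)]
    exact_mod_cast h2

theorem exists_ne_zero_of_eval_ne_zero (hf : f.IsHomogeneous D) (hD : D ≠ 0) {u : σ → ℤ}
    (hu : MvPolynomial.eval u f ≠ 0) : ∃ i, u i ≠ 0 := by
  by_contra! h
  have h1 := eval₂_mul_of_isHomogeneous hf (RingHom.id ℤ) 0 u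
  rw [zero_pow hD, zero_mul, MvPolynomial.eval₂_id] at h1
  refine hu (Eq.trans ?_ h1)
  congr 2
  funext l
  rw [h, zero_mul]

theorem shiftedEval_eq_zero (hf : f.IsHomogeneous D) {q : ℕ} {a u w : σ → ℤ} (i : σ)
    (h : MvPolynomial.eval (fun l => a l + q * w l) f = 0) :
    shiftedEval f q (fun l => u i * a l) u (fun l => u i * w l - u l * w i) (w i) = 0 := by
  have h1 : f.eval₂ (Int.castRingHom ℚ) (fun l => ((a l + q * w l : ℤ) : ℚ)) = 0 := by
    have h2 := congrArg (Int.castRingHom ℚ) h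
    rw [← MvPolynomial.eval₂_id, MvPolynomial.eval₂_comp_left, map_zero] at h2
    exact h2
  have h3 := eval₂_mul_of_isHomogeneous hf (Int.castRingHom ℚ) (u i)
    fun l => ((a l + q * w l : ℤ) : ℚ)
  rw [h1, mul_zero] at h3
  rw [← h3, shiftedEval]
  refine congrArg (fun g => MvPolynomial.eval₂ _ g f) (funext fun l => ?_)
  push_cast
  ring

theorem rpow_le_of_le_mul_max {B R M e : ℝ} (hB : 1 ≤ B) (hR : 0 ≤ R) (hM : 0 ≤ M)
    (h : B ≤ M * max 1 R) : B ^ e ≤ (1 + M ^ e) * (1 + R ^ e) := by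
  have h1 : 0 ≤ M ^ e := Real.rpow_nonneg hM e
  have h2 : 0 ≤ R ^ e := Real.rpow_nonneg hR e
  rcases le_total e 0 with he | he
  · have := Real.rpow_le_one_of_one_le_of_nonpos hB he
    nlinarith [mul_nonneg h1 h2]
  · have h3 : B ^ e ≤ M ^ e * max 1 R ^ e := by
      rw [← Real.mul_rpow hM (by positivity)]
      exact Real.rpow_le_rpow (by linarith) h he
    have h4 : max 1 R ^ e ≤ 1 + R ^ e := by
      rcases max_cases 1 R with ⟨h, -⟩ | ⟨h, -⟩ <;> rw [h]
      · rw [Real.one_rpow]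
        linarith
      · linarith
    nlinarith [mul_le_mul_of_nonneg_left h4 h1]

theorem ceil_le_and_le_add {x : ℤ} {ω r : ℝ} {B : ℕ} (h : |(x : ℝ) - ω| ≤ r) (hB : 2 * r ≤ B) :
    ⌈ω - r⌉ ≤ x ∧ x ≤ ⌈ω - r⌉ + B := by
  obtain ⟨h1, h2⟩ := abs_le.mp h
  refine ⟨Int.ceil_le.mpr (by linarith), ?_⟩
  have := Int.le_ceil (ω - r)
  have h3 : (x : ℝ) ≤ ⌈ω - r⌉ + B := by linarith
  exact_mod_cast h3

theorem card_points_le [DecidableEq σ] [Fintype σ] (hf : f.IsHomogeneous D) (hD : 2 ≤ D)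
    (hirr : Irreducible (f.map (Int.castRingHom ℂ))) {ε K : ℝ} {m : ℕ} (hK : 0 ≤ K)
    (hm : Fintype.card σ = m + 1) (hbd : SporadicBound σ D ε m K)
    {q : ℕ} (hq : 0 < q) {X : ℝ} (hX : 0 ≤ X) (v₀ a : σ → ℤ) (V : Finset (σ → ℤ))
    (hV : ∀ v ∈ V, (∀ l, |(v l : ℝ) - v₀ l| ≤ X) ∧ MvPolynomial.eval v f = 0 ∧
      ∀ l, (q : ℤ) ∣ v l - a l) :
    (V.card : ℝ) ≤ K * (1 + (4 * D + 2 : ℝ) ^ ((m : ℝ) - 1 / 2 + ε)) *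
      (1 + (X / q) ^ ((m : ℝ) - 1 / 2 + ε)) := by
  have hq' : (0 : ℝ) < q := by exact_mod_cast hq
  have hD' : (2 : ℝ) ≤ D := by exact_mod_cast hD
  have h0 : f ≠ 0 := by
    rintro rfl
    exact hirr.ne_zero (map_zero _)
  obtain ⟨u, huD, hu⟩ := exists_eval_ne_zero_of_isHomogeneous hf h0
  obtain ⟨i, hi⟩ := exists_ne_zero_of_eval_ne_zero hf (by omega) hu
  have hw : ∀ v ∈ V, ∃ w : σ → ℤ, v = fun l => a l + q * w l := by
    intro v hv
    choose w hw using (hV v hv).2.2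
    exact ⟨w, funext fun l => by rw [← hw]; ring⟩
  choose! w hw using hw
  set R := X / q
  have hR : 0 ≤ R := by positivity
  let ω (l : σ) : ℝ := ((v₀ l : ℝ) - a l) / q
  have hwω : ∀ v ∈ V, ∀ l, |(w v l : ℝ) - ω l| ≤ R := by
    intro v hv l
    have h1 := (hV v hv).1 l
    have h2 : (v l : ℝ) - v₀ l = q * (w v l - ω l) := by
      rw [congrFun (hw v hv) l]
      simp only [ω]
      push_cast
      field_simp
      ring
    rwa [h2, abs_mul, abs_of_pos hq', ← le_div_iff₀' hq'] at h1
  obtain ⟨B, hBR, hRB⟩ : ∃ B : ℕ, 4 * D * R + 1 ≤ B ∧ (B : ℝ) ≤ 4 * D * R + 2 := by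
    refine ⟨⌈4 * D * R + 1⌉₊, Nat.le_ceil _, ?_⟩
    have := (Nat.ceil_lt_add_one (a := 4 * D * R + 1) (by positivity)).le
    linarith
  have hDR : 0 ≤ D * R := by positivity
  have hB1 : (1 : ℝ) ≤ B := by linarith
  let g (v : σ → ℤ) : (σ → ℤ) × ℤ := (fun l => u i * w v l - u l * w v i, w v i)
  have hg : Set.InjOn g V := fun v hv v' hv' h => by
    simp only [g, Prod.mk.injEq] at h
    rw [hw v hv, hw v' hv']
    funext l
    have h1 := congrFun h.1 l
    rw [h.2, sub_left_inj] at h1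
    rw [mul_left_cancel₀ hi h1]
  have hcard := hbd (shiftedEval f q (fun l => u i * a l) u) 0
    (fun l => ⌈(u i * ω l - u l * ω i) - 2 * D * R⌉) (Finset.univ.erase i) ⌈ω i - R⌉ B
    (isCurveFamily_shiftedEval hf hq _ hu)
    (by rw [Finset.card_erase_of_mem (Finset.mem_univ i), Finset.card_univ, hm]; rfl)
    (by exact_mod_cast hB1) (V.image g) ?_
  · rw [Finset.card_image_of_injOn hg] at hcard
    rw [mul_assoc]
    refine hcard.trans (mul_le_mul_of_nonneg_left
      (rpow_le_of_le_mul_max hB1 hR (by positivity) ?_) hK)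
    have h1 : 4 * D * R ≤ 4 * D * max 1 R := by gcongr; exact le_max_right _ _
    have h2 := le_max_left 1 R
    linarith
  · intro P hP
    obtain ⟨v, hv, rfl⟩ := Finset.mem_image.mp hP
    refine ⟨mem_coordBox.mpr ⟨fun l _ => ceil_le_and_le_add ?_ (by linarith), fun l hl => ?_⟩,
      ceil_le_and_le_add (hwω v hv i) ?_, shiftedEval_eq_zero hf i ?_, fun F hF =>
      absurd hF (not_isComponent_shiftedEval hf hD hirr hq a hu hi F)⟩
    · have h1 : ((u i * w v l - u l * w v i : ℤ) : ℝ) - (u i * ω l - u l * ω i) =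
          u i * (w v l - ω l) - u l * (w v i - ω i) := by
        push_cast
        ring
      rw [h1]
      calc _ ≤ |u i * (w v l - ω l)| + |u l * (w v i - ω i)| := abs_sub _ _
        _ ≤ D * R + D * R := by
          rw [abs_mul, abs_mul]
          exact add_le_add
            (mul_le_mul (huD i) (hwω v hv l) (abs_nonneg _) (by positivity))
            (mul_le_mul (huD l) (hwω v hv i) (abs_nonneg _) (by positivity))
        _ = 2 * D * R := by ring
    · obtain rfl : l = i := by simpa using hl
      simp [g]
    · nlinarith
    · rw [← hw v hv]
      exact (hV v hv).2.1

end Counting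

open MvPolynomial

/-- For an absolutely irreducible form `f*` of degree `D ≥ 2` in `n` variables,
the number of integer points `v` with `|v − v₀| ≤ X`, `f*(v) = 0` and
`v ≡ a (mod q)` is `≪_{n,D,ε} 1 + (X/q)^{n − 3/2 + ε}`, uniformly in `v₀`, `a`
and the coefficients of `f*`. -/
theorem count_points_congruence (n D : ℕ) (hD : 2 ≤ D) (ε : ℝ) (hε : 0 < ε) :
    ∃ C : ℝ, 0 < C ∧
      ∀ (q : ℕ) (X : ℝ) (v₀ a : Fin n → ℤ) (f : MvPolynomial (Fin n) ℤ),
        0 < q → 1 ≤ X →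
        f.IsHomogeneous D →
        Irreducible (f.map (Int.castRingHom ℂ)) →
        ({v : Fin n → ℤ |
            (∀ i, (|v i - v₀ i| : ℝ) ≤ X) ∧
            eval v f = 0 ∧
            ∀ i, (q : ℤ) ∣ (v i - a i)}).ncard ≤
          C * (1 + (X / q) ^ ((n : ℝ) - 3/2 + ε)) := by
  obtain ⟨K, hK, hbd⟩ := exists_sporadicBound (σ := Fin n) D hε (n - 1)
  refine ⟨K * (1 + (4 * D + 2 : ℝ) ^ (((n - 1 : ℕ) : ℝ) - 1 / 2 + ε)) + 1, by positivity, ?_⟩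
  intro q X v₀ a f hq hX hf hirr
  set V := {v : Fin n → ℤ | (∀ i, (|v i - v₀ i| : ℝ) ≤ X) ∧ eval v f = 0 ∧
    ∀ i, (q : ℤ) ∣ (v i - a i)}
  have hpos : 0 ≤ 1 + (X / q) ^ ((n : ℝ) - 3 / 2 + ε) := by positivity
  rcases V.finite_or_infinite with hV | hV
  · rw [Set.ncard_eq_toFinset_card V hV]
    obtain ⟨m, rfl⟩ : ∃ m, n = m + 1 := by
      refine Nat.exists_eq_succ_of_ne_zero ?_
      rintro rfl
      have h0 : f ≠ 0 := by
        rintro rfl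
        exact hirr.ne_zero (map_zero _)
      have := hf.inj_right (isHomogeneous_of_isEmpty _ _ f) h0
      omega
    have h := card_points_le hf hD hirr hK (Fintype.card_fin _) hbd hq (by linarith) v₀ a
      hV.toFinset fun v hv => hV.mem_toFinset.mp hv
    rw [Nat.add_sub_cancel]
    have he : ((m + 1 : ℕ) : ℝ) - 3 / 2 + ε = (m : ℝ) - 1 / 2 + ε := by
      push_cast
      ring
    rw [he] at hpos ⊢
    linarith
  · rw [hV.ncard, Nat.cast_zero]
    positivity
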